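/- There exists an absolute constant c₂ > 0 with the following property. Let W be a probability measure on ℝ, let α > 0, and let D be a probability measure on ℝ whose characteristic function equals exp(α(Ŵ(t) − 1)) for all t ∈ ℝ, where Ŵ is the characteristic function of W. Then for every τ ≥ 0, r ∈ ℕ₀ and m ∈ ℕ with β_{r,m}(W,τ) > 0, one has Q(D, τ) ≤ c₂^{r+1} · ( 1/(m·√(α·β_{r,m}(W,τ))) + (r+1)^{5r/2}/(α·β_{r,m}(W,τ))^{(r+1)/2} ). -/

import Mathlib

open MeasureTheory ProbabilityTheory Metric Finset

/-- The concentration function `Q(F, τ) = sup_x F {y : dist y x ≤ τ/2}`. -/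
noncomputable def concFn {E : Type*} [MeasurableSpace E] [PseudoMetricSpace E]
    (μ : Measure E) (τ : ℝ) : ℝ :=
  ⨆ x : E, (μ (Metric.closedBall x (τ / 2))).toReal

/-- `IsCGAP r m K` means that `K` belongs to the class `𝒦_{r,m}` of CGAPs:
`K = {⟨ν, h⟩ : ν ∈ ℤ^r ∩ V}` for some `h ∈ ℝ^r` and some closed symmetric convex
set `V ⊆ ℝ^r` containing at most `m` points with integer coordinates. -/
def IsCGAP (r m : ℕ) (K : Set ℝ) : Prop :=
  ∃ (h : Fin r → ℝ) (V : Set (Fin r → ℝ)),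
    IsClosed V ∧ Convex ℝ V ∧ (∀ x ∈ V, -x ∈ V) ∧
    {ν : Fin r → ℤ | (fun i => (ν i : ℝ)) ∈ V}.Finite ∧
    {ν : Fin r → ℤ | (fun i => (ν i : ℝ)) ∈ V}.ncard ≤ m ∧
    K = (fun ν : Fin r → ℤ => ∑ i, (ν i : ℝ) * h i) ''
      {ν : Fin r → ℤ | (fun i => (ν i : ℝ)) ∈ V}

/-- `beta r m W τ = inf_{K ∈ 𝒦_{r,m}} W(ℝ \ [K]_τ)`, where `[K]_τ` is the closed
`τ`-neighborhood of `K`. -/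
noncomputable def beta (r m : ℕ) (W : Measure ℝ) (τ : ℝ) : ℝ :=
  ⨅ K : {K : Set ℝ // IsCGAP r m K}, (W ((Metric.cthickening τ (K : Set ℝ))ᶜ)).toReal

/-- The cosine transform of the triangular kernel of width `T`. -/
noncomputable def tri (T κ : ℝ) : ℝ := ∫ t in (-T)..T, (1 - |t| / T) * Real.cos (κ * t)

lemma tri_eq_half {T : ℝ} (hT : 0 < T) (κ : ℝ) :
    tri T κ = 2 * ∫ t in (0 : ℝ)..T, (1 - t / T) * Real.cos (κ * t) := by
  have hc : Continuous fun t : ℝ => (1 - |t| / T) * Real.cos (κ * t) := by fun_prop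
  have hpos : ∫ t in (0 : ℝ)..T, (1 - |t| / T) * Real.cos (κ * t)
      = ∫ t in (0 : ℝ)..T, (1 - t / T) * Real.cos (κ * t) := by
    apply intervalIntegral.integral_congr
    intro t ht
    rw [Set.uIcc_of_le hT.le] at ht
    simp only [abs_of_nonneg ht.1]
  have hneg : ∫ t in (-T)..0, (1 - |t| / T) * Real.cos (κ * t)
      = ∫ t in (0 : ℝ)..T, (1 - |t| / T) * Real.cos (κ * t) := by
    have := intervalIntegral.integral_comp_neg (a := 0) (b := T)
      (fun t : ℝ => (1 - |t| / T) * Real.cos (κ * t))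
    simp only [neg_zero, abs_neg, mul_neg, Real.cos_neg] at this
    exact this.symm
  rw [tri, ← intervalIntegral.integral_add_adjacent_intervals
    (hc.intervalIntegrable (-T) 0) (hc.intervalIntegrable 0 T), hneg, hpos]
  ring

lemma tri_of_ne {T κ : ℝ} (hT : 0 < T) (hκ : κ ≠ 0) :
    tri T κ = 2 * (1 - Real.cos (κ * T)) / (κ ^ 2 * T) := by
  have hd : ∀ t ∈ Set.uIcc 0 T, HasDerivAt
      (fun t : ℝ => (1 - t / T) * (Real.sin (κ * t) / κ) - Real.cos (κ * t) / (T * κ ^ 2))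
      ((1 - t / T) * Real.cos (κ * t)) t := by
    intro t _
    have h1 : HasDerivAt (fun t : ℝ => κ * t) κ t := by
      simpa using (hasDerivAt_id t).const_mul κ
    have h2 : HasDerivAt (fun t : ℝ => 1 - t / T) (-(1 / T)) t := by
      simpa using ((hasDerivAt_id t).div_const T).const_sub 1
    have h3 := (h2.mul (h1.sin.div_const κ)).sub (h1.cos.div_const (T * κ ^ 2))
    refine h3.congr_deriv ?_
    field_simp
    ring
  rw [tri_eq_half hT, intervalIntegral.integral_eq_sub_of_hasDerivAt hd
    (Continuous.intervalIntegrable (by fun_prop) _ _)]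
  simp
  field_simp
  ring

lemma tri_zero {T : ℝ} (hT : 0 < T) : tri T 0 = T := by
  have hd : ∀ t ∈ Set.uIcc 0 T, HasDerivAt (fun t : ℝ => t - t ^ 2 / (2 * T))
      ((1 - t / T) * Real.cos (0 * t)) t := by
    intro t _
    have h := (hasDerivAt_id t).sub (((hasDerivAt_id t).pow 2).div_const (2 * T))
    refine h.congr_deriv ?_
    simp
    field_simp
  rw [tri_eq_half hT, intervalIntegral.integral_eq_sub_of_hasDerivAt hd
    (Continuous.intervalIntegrable (by fun_prop) _ _)]
  field_simp
  ring

lemma tri_nonneg {T : ℝ} (hT : 0 < T) (κ : ℝ) : 0 ≤ tri T κ := by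
  by_cases hκ : κ = 0
  · rw [hκ, tri_zero hT]; exact hT.le
  · rw [tri_of_ne hT hκ]
    have := Real.cos_le_one (κ * T)
    have : 0 ≤ 1 - Real.cos (κ * T) := by linarith
    positivity

lemma tri_le_of_ne {T κ : ℝ} (hT : 0 < T) (hκ : κ ≠ 0) : tri T κ ≤ 4 / (κ ^ 2 * T) := by
  rw [tri_of_ne hT hκ]
  have := Real.neg_one_le_cos (κ * T)
  gcongr
  linarith

lemma tri_le {T : ℝ} (hT : 0 < T) (κ : ℝ) : tri T κ ≤ T := by
  by_cases hκ : κ = 0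
  · rw [hκ, tri_zero hT]
  · rw [tri_of_ne hT hκ]
    have := Real.one_sub_sq_div_two_le_cos (x := κ * T)
    rw [div_le_iff₀ (by positivity)]
    nlinarith

lemma le_tri {T κ : ℝ} (hT : 0 < T) (hκ : |κ * T| ≤ Real.pi) : T / 3 ≤ tri T κ := by
  by_cases h0 : κ = 0
  · rw [h0, tri_zero hT]; linarith
  · rw [tri_of_ne hT h0]
    have h := Real.cos_le_one_sub_mul_cos_sq hκ
    rw [le_div_iff₀ (by positivity)]
    have h4 : (1 : ℝ) / 6 ≤ 2 / Real.pi ^ 2 := by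
      rw [div_le_div_iff₀ (by norm_num) (by positivity)]
      nlinarith [Real.pi_lt_d2, Real.pi_pos]
    nlinarith [sq_nonneg (κ * T)]

lemma tri_le_floor {T : ℝ} (hT : 0 < T) (z w : ℝ) :
    tri (2 * T) (2 * Real.pi * (z - w)) ≤
      20 * T * (1 / (1 + ((⌊2 * T * z⌋ - ⌊2 * T * w⌋ : ℤ) : ℝ) ^ 2)) := by
  set k : ℤ := ⌊2 * T * z⌋ - ⌊2 * T * w⌋ with hk
  have hk1 : |(k : ℝ)| ≤ 2 * T * |z - w| + 1 := by
    have h1 := Int.floor_le (2 * T * z)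
    have h2 := Int.lt_floor_add_one (2 * T * z)
    have h3 := Int.floor_le (2 * T * w)
    have h4 := Int.lt_floor_add_one (2 * T * w)
    have h5 := le_abs_self (z - w)
    have h6 := neg_abs_le (z - w)
    have h7 : 2 * T * (z - w) ≤ 2 * T * |z - w| := by gcongr
    have h8 : 2 * T * (-|z - w|) ≤ 2 * T * (z - w) := by gcongr
    rw [hk]; push_cast
    rw [abs_le]
    constructor <;> linarith
  have hk2 : (k : ℝ) ^ 2 ≤ (2 * T * |z - w| + 1) ^ 2 := by
    rw [← sq_abs (k : ℝ)]
    gcongr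
  rw [mul_one_div, le_div_iff₀ (by positivity)]
  rcases le_or_gt (2 * T * |z - w|) 1 with h | h
  · have := tri_le (T := 2 * T) (by positivity) (2 * Real.pi * (z - w))
    have h0 := tri_nonneg (T := 2 * T) (by positivity) (2 * Real.pi * (z - w))
    have : (k : ℝ) ^ 2 ≤ 4 := by
      have : 0 ≤ 2 * T * |z - w| := by positivity
      nlinarith
    nlinarith
  · have hne : z - w ≠ 0 := by
      intro h0; rw [h0] at h; norm_num at h
    have hle := tri_le_of_ne (T := 2 * T) (κ := 2 * Real.pi * (z - w)) (by positivity)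
      (by positivity)
    have hk3 : 1 + (k : ℝ) ^ 2 ≤ 20 * T ^ 2 * (z - w) ^ 2 := by
      rw [← sq_abs (z - w)]
      nlinarith
    calc tri (2 * T) (2 * Real.pi * (z - w)) * (1 + (k : ℝ) ^ 2)
        ≤ 4 / ((2 * Real.pi * (z - w)) ^ 2 * (2 * T)) * (20 * T ^ 2 * (z - w) ^ 2) := by
          gcongr
      _ = 10 * T / Real.pi ^ 2 := by field_simp; ring
      _ ≤ 20 * T := by
          rw [div_le_iff₀ (by positivity)]
          nlinarith [Real.pi_gt_three, mul_pos hT Real.pi_pos]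

lemma sq_integral_le {Ω : Type*} [MeasurableSpace Ω] {ν : Measure Ω} [IsProbabilityMeasure ν]
    {g : Ω → ℝ} (hg : Integrable g ν) (hg2 : Integrable (fun t => g t ^ 2) ν) :
    (∫ t, g t ∂ν) ^ 2 ≤ ∫ t, g t ^ 2 ∂ν := by
  set m := ∫ t, g t ∂ν with hm
  have h : 0 ≤ ∫ t, (g t - m) ^ 2 ∂ν := integral_nonneg fun t => sq_nonneg _
  have h2 : ∫ t, (g t - m) ^ 2 ∂ν = (∫ t, g t ^ 2 ∂ν) - m ^ 2 := by
    have : ∀ t, (g t - m) ^ 2 = g t ^ 2 - (2 * m) * g t + m ^ 2 := fun t => by ring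
    simp_rw [this]
    rw [integral_add (by fun_prop) (by fun_prop), integral_sub hg2 (by fun_prop),
      integral_const_mul, ← hm]
    simp
    ring
  linarith

lemma integral_le_of_measure_le {T q : ℝ} (hT : 0 < T) (hq : 0 ≤ q) {ν : Measure ℝ}
    (hν : ν ≤ ENNReal.ofReal q • (volume.restrict (Set.Icc (-T) T)))
    {Q : ℝ → ℝ} (hQ : Continuous Q) (h0 : ∀ t, 0 ≤ Q t) :
    ∫ t, Q t ∂ν ≤ q * ∫ t in (-T)..T, Q t := by
  have hi : IntegrableOn Q (Set.Icc (-T) T) := hQ.integrableOn_Icc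
  calc ∫ t, Q t ∂ν ≤ ∫ t, Q t ∂(ENNReal.ofReal q • (volume.restrict (Set.Icc (-T) T))) := by
        apply integral_mono_measure hν (Filter.Eventually.of_forall h0)
        exact hi.smul_measure (by simp)
    _ = q * ∫ t in (-T)..T, Q t := by
        rw [integral_smul_measure, ENNReal.toReal_ofReal hq,
          intervalIntegral.integral_of_le (by linarith), integral_Icc_eq_integral_Ioc, smul_eq_mul]

/-- A large sieve bound: if `ν` has density at most `1 / (p T)` on `[-T, T]`, then few separated
points can have a large cosine transform. -/
lemma exists_sieve_const : ∃ C : ℝ, 1 ≤ C ∧ ∀ (T p : ℝ) (ν : Measure ℝ),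
    0 < T → 0 < p → IsProbabilityMeasure ν →
    ν ≤ ENNReal.ofReal (1 / (p * T)) • (volume.restrict (Set.Icc (-T) T)) →
    ∀ Z : Finset ℝ, (∀ z ∈ Z, ∀ w ∈ Z, z ≠ w → 1 / (2 * T) ≤ |z - w|) →
    (∀ z ∈ Z, 1 / 2 ≤ ∫ t, Real.cos (2 * Real.pi * (t * z)) ∂ν) → (#Z : ℝ) ≤ C / p := by
  have hsum : Summable fun k : ℤ => 1 / (1 + (k : ℝ) ^ 2) := by
    have h2 : Summable fun k : ℤ => 1 / (k : ℝ) ^ 2 :=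
      Real.summable_one_div_int_pow.mpr (by norm_num)
    refine h2.of_norm_bounded_eventually ?_
    filter_upwards [(Set.finite_singleton (0 : ℤ)).compl_mem_cofinite] with k hk
    have hk0 : (k : ℝ) ≠ 0 := by exact_mod_cast hk
    rw [Real.norm_of_nonneg (by positivity)]
    gcongr
    linarith
  set S := ∑' k : ℤ, 1 / (1 + (k : ℝ) ^ 2) with hS
  have hS0 : 0 ≤ S := tsum_nonneg fun k => by positivity
  refine ⟨160 * S + 1, by linarith, ?_⟩
  intro T p ν hT hp _ hν Z hsep hcos
  set Q : ℝ → ℝ := fun t => ∑ z ∈ Z, ∑ w ∈ Z, Real.cos (2 * Real.pi * (z - w) * t) with hQdef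
  have hQc : Continuous Q := by fun_prop
  have hQ : ∀ t, Q t = (∑ z ∈ Z, Real.cos (2 * Real.pi * (t * z))) ^ 2 +
      (∑ z ∈ Z, Real.sin (2 * Real.pi * (t * z))) ^ 2 := by
    intro t
    rw [sq, sq, Finset.sum_mul_sum, Finset.sum_mul_sum, ← Finset.sum_add_distrib]
    refine Finset.sum_congr rfl fun z _ => ?_
    rw [← Finset.sum_add_distrib]
    refine Finset.sum_congr rfl fun w _ => ?_
    rw [← Real.cos_sub]
    congr 1; ring
  have hQ0 : ∀ t, 0 ≤ Q t := fun t => by rw [hQ]; positivity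
  have hrow : ∀ z ∈ Z, ∑ w ∈ Z, tri (2 * T) (2 * Real.pi * (z - w)) ≤ 20 * T * S := by
    intro z _
    calc ∑ w ∈ Z, tri (2 * T) (2 * Real.pi * (z - w))
        ≤ ∑ w ∈ Z, 20 * T * (1 / (1 + ((⌊2 * T * z⌋ - ⌊2 * T * w⌋ : ℤ) : ℝ) ^ 2)) :=
          Finset.sum_le_sum fun w _ => tri_le_floor hT z w
      _ = 20 * T * ∑ w ∈ Z, (1 / (1 + ((⌊2 * T * z⌋ - ⌊2 * T * w⌋ : ℤ) : ℝ) ^ 2)) := by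
          rw [Finset.mul_sum]
      _ ≤ 20 * T * S := by
          gcongr
          have hinj : Set.InjOn (fun w : ℝ => ⌊2 * T * z⌋ - ⌊2 * T * w⌋) Z := by
            intro v hv w hw hvw
            by_contra hne
            have h1 := hsep v hv w hw hne
            have hfl : ⌊2 * T * v⌋ = ⌊2 * T * w⌋ := by simpa using hvw
            have h2 := Int.abs_sub_lt_one_of_floor_eq_floor hfl
            rw [← mul_sub, abs_mul, abs_of_pos (by positivity : 0 < 2 * T)] at h2
            rw [div_le_iff₀ (by positivity)] at h1
            linarith
          rw [← Finset.sum_image (f := fun k : ℤ => 1 / (1 + (k : ℝ) ^ 2)) hinj]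
          exact hsum.sum_le_tsum _ fun k _ => by positivity
  have hInt : ∫ t in (-(2 * T))..(2 * T), (1 - |t| / (2 * T)) * Q t ≤ #Z * (20 * T * S) := by
    have : ∫ t in (-(2 * T))..(2 * T), (1 - |t| / (2 * T)) * Q t
        = ∑ z ∈ Z, ∑ w ∈ Z, tri (2 * T) (2 * Real.pi * (z - w)) := by
      simp only [hQdef, Finset.mul_sum]
      rw [intervalIntegral.integral_finsetSum
        (fun z _ => Continuous.intervalIntegrable (by fun_prop) _ _)]
      refine Finset.sum_congr rfl fun z _ => ?_
      rw [intervalIntegral.integral_finsetSum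
        (fun z _ => Continuous.intervalIntegrable (by fun_prop) _ _)]
      rfl
    rw [this, ← nsmul_eq_mul]
    exact Finset.sum_le_card_nsmul _ _ _ hrow
  have hInt2 : ∫ t in (-T)..T, Q t ≤ 2 * (#Z * (20 * T * S)) := by
    calc ∫ t in (-T)..T, Q t ≤ ∫ t in (-T)..T, 2 * ((1 - |t| / (2 * T)) * Q t) := by
          apply intervalIntegral.integral_mono_on (by linarith)
            (hQc.intervalIntegrable _ _) (Continuous.intervalIntegrable (by fun_prop) _ _)
          intro t ht
          have : |t| / (2 * T) ≤ 1 / 2 := by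
            rw [div_le_iff₀ (by positivity)]
            have := abs_le.mpr ht
            linarith
          nlinarith [hQ0 t]
      _ ≤ ∫ t in (-(2 * T))..(2 * T), 2 * ((1 - |t| / (2 * T)) * Q t) := by
          apply intervalIntegral.integral_mono_interval (by linarith) (by linarith) (by linarith)
          · filter_upwards [ae_restrict_mem measurableSet_Ioc] with t ht
            have : |t| / (2 * T) ≤ 1 := by
              rw [div_le_iff₀ (by positivity), one_mul]
              exact abs_le.mpr ⟨ht.1.le, ht.2⟩
            have := hQ0 t
            simp only [Pi.zero_apply]
            have : 0 ≤ 1 - |t| / (2 * T) := by linarith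
            positivity
          · exact Continuous.intervalIntegrable (by fun_prop) _ _
      _ ≤ _ := by
          rw [intervalIntegral.integral_const_mul]
          gcongr
  have hbd : ∀ f : ℝ → ℝ, Continuous f → (∃ B, ∀ t, ‖f t‖ ≤ B) → Integrable f ν := by
    rintro f hf ⟨B, hB⟩
    exact Integrable.of_bound hf.aestronglyMeasurable B (Filter.Eventually.of_forall hB)
  have hcosb : ∀ t, ‖∑ z ∈ Z, Real.cos (2 * Real.pi * (t * z))‖ ≤ #Z := by
    intro t
    refine (norm_sum_le _ _).trans ?_
    refine (Finset.sum_le_card_nsmul _ _ 1 fun z _ => ?_).trans (by simp)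
    exact Real.abs_cos_le_one _
  have hQb : ∃ B, ∀ t, ‖Q t‖ ≤ B := by
    refine ⟨#Z • (#Z • 1), fun t => (norm_sum_le _ _).trans ?_⟩
    refine Finset.sum_le_card_nsmul _ _ _ fun z _ => (norm_sum_le _ _).trans ?_
    exact Finset.sum_le_card_nsmul _ _ _ fun w _ => Real.abs_cos_le_one _
  have h1 : (#Z : ℝ) * (1 / 2) ≤ ∫ t, ∑ z ∈ Z, Real.cos (2 * Real.pi * (t * z)) ∂ν := by
    rw [integral_finsetSum _ fun z _ => hbd _ (by fun_prop) ⟨1, fun t => Real.abs_cos_le_one _⟩,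
      ← nsmul_eq_mul]
    exact Finset.card_nsmul_le_sum _ _ _ hcos
  have h2 := sq_integral_le (ν := ν) (hbd _ (by fun_prop) ⟨_, hcosb⟩)
    (hbd (fun t => (∑ z ∈ Z, Real.cos (2 * Real.pi * (t * z))) ^ 2) (by fun_prop)
      ⟨(#Z : ℝ) ^ 2, fun t => by rw [norm_pow]; gcongr; exact hcosb t⟩)
  have h3 : ∫ t, (∑ z ∈ Z, Real.cos (2 * Real.pi * (t * z))) ^ 2 ∂ν ≤ ∫ t, Q t ∂ν := by
    apply integral_mono
    · exact hbd _ (by fun_prop) ⟨(#Z : ℝ) ^ 2, fun t => by rw [norm_pow]; gcongr; exact hcosb t⟩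
    · exact hbd _ hQc hQb
    · intro t
      simp only [hQ t]
      nlinarith [sq_nonneg (∑ z ∈ Z, Real.sin (2 * Real.pi * (t * z)))]
  have h4 := integral_le_of_measure_le hT (by positivity) hν hQc hQ0
  have h5 : ((#Z : ℝ) * (1 / 2)) ^ 2 ≤ 1 / (p * T) * (2 * (#Z * (20 * T * S))) := by
    calc ((#Z : ℝ) * (1 / 2)) ^ 2
        ≤ (∫ t, ∑ z ∈ Z, Real.cos (2 * Real.pi * (t * z)) ∂ν) ^ 2 := by gcongr
      _ ≤ _ := h2.trans (h3.trans (h4.trans (by gcongr)))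
  rcases (Nat.cast_nonneg (α := ℝ) #Z).eq_or_lt with h0 | h0
  · rw [← h0]; positivity
  · have h6 : 1 / (p * T) * (2 * (#Z * (20 * T * S))) = #Z * (40 * S / p) := by
      field_simp; ring
    rw [h6] at h5
    have h7 : (#Z : ℝ) / 4 ≤ 40 * S / p := by
      have : (#Z : ℝ) * (#Z / 4) ≤ #Z * (40 * S / p) := by nlinarith
      exact le_of_mul_le_mul_left this h0
    rw [le_div_iff₀ hp]
    rw [div_le_div_iff₀ (by norm_num) hp] at h7
    linarith

/-- The exponent `1 - Re Ŵ(2πt)`. -/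
noncomputable def cosDef (W : Measure ℝ) (t : ℝ) : ℝ :=
  ∫ x, (1 - Real.cos (2 * Real.pi * (t * x))) ∂W

lemma cosDef_continuous (W : Measure ℝ) [IsProbabilityMeasure W] : Continuous (cosDef W) := by
  refine continuous_of_dominated (bound := fun _ => 2) ?_ ?_ (by fun_prop) ?_
  · exact fun t => (by fun_prop : Continuous fun x : ℝ =>
      1 - Real.cos (2 * Real.pi * (t * x))).aestronglyMeasurable
  · intro t
    refine Filter.Eventually.of_forall fun x => ?_
    rw [Real.norm_eq_abs, abs_le]
    have := Real.cos_le_one (2 * Real.pi * (t * x))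
    have := Real.neg_one_le_cos (2 * Real.pi * (t * x))
    constructor <;> linarith
  · exact Filter.Eventually.of_forall fun x => by fun_prop

lemma cosDef_nonneg (W : Measure ℝ) (t : ℝ) : 0 ≤ cosDef W t :=
  integral_nonneg fun x => by
    have := Real.cos_le_one (2 * Real.pi * (t * x))
    simp only [Pi.zero_apply]; linarith

/-- The mean of `exp (-a (1 - Re Ŵ(2πt)))` with respect to the triangular density on `[-T, T]`. -/
noncomputable def triMean (W : Measure ℝ) (T a : ℝ) : ℝ :=
  1 / T * ∫ t in (-T)..T, (1 - |t| / T) * Real.exp (-a * cosDef W t)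

lemma integral_tri {T : ℝ} (hT : 0 < T) : ∫ t in (-T)..T, (1 - |t| / T) = T := by
  have := tri_zero hT
  simpa [tri] using this

lemma one_sub_abs_div_nonneg {T t : ℝ} (hT : 0 < T) (ht : t ∈ Set.Icc (-T) T) :
    0 ≤ 1 - |t| / T := by
  rw [sub_nonneg, div_le_one hT]
  exact abs_le.mpr ht

lemma triMean_le_one (W : Measure ℝ) [IsProbabilityMeasure W] {T a : ℝ} (hT : 0 < T)
    (ha : 0 ≤ a) : triMean W T a ≤ 1 := by
  have hc := cosDef_continuous W
  have : ∫ t in (-T)..T, (1 - |t| / T) * Real.exp (-a * cosDef W t) ≤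
      ∫ t in (-T)..T, (1 - |t| / T) := by
    apply intervalIntegral.integral_mono_on (by linarith)
      (Continuous.intervalIntegrable (by fun_prop) _ _)
      (Continuous.intervalIntegrable (by fun_prop) _ _)
    intro t ht
    have h1 := one_sub_abs_div_nonneg hT ht
    have h2 : Real.exp (-a * cosDef W t) ≤ 1 := by
      rw [Real.exp_le_one_iff]
      nlinarith [mul_nonneg ha (cosDef_nonneg W t)]
    nlinarith
  rw [integral_tri hT] at this
  rw [triMean, one_div, inv_mul_le_iff₀ hT]
  linarith

lemma cosDef_le_two (W : Measure ℝ) [IsProbabilityMeasure W] (t : ℝ) : cosDef W t ≤ 2 := by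
  have : cosDef W t ≤ ∫ x, (2 : ℝ) ∂W := by
    apply integral_mono
    · refine Integrable.of_bound (by fun_prop) 2 (Filter.Eventually.of_forall fun x => ?_)
      rw [Real.norm_eq_abs, abs_le]
      have := Real.cos_le_one (2 * Real.pi * (t * x))
      have := Real.neg_one_le_cos (2 * Real.pi * (t * x))
      constructor <;> linarith
    · exact integrable_const _
    · intro x
      have := Real.neg_one_le_cos (2 * Real.pi * (t * x))
      simp only; linarith
  simpa using this

lemma triMean_pos (W : Measure ℝ) [IsProbabilityMeasure W] {T a : ℝ} (hT : 0 < T)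
    (ha : 0 ≤ a) : 0 < triMean W T a := by
  have hc := cosDef_continuous W
  have : ∫ t in (-T)..T, (1 - |t| / T) * Real.exp (-a * 2) ≤
      ∫ t in (-T)..T, (1 - |t| / T) * Real.exp (-a * cosDef W t) := by
    apply intervalIntegral.integral_mono_on (by linarith)
      (Continuous.intervalIntegrable (by fun_prop) _ _)
      (Continuous.intervalIntegrable (by fun_prop) _ _)
    intro t ht
    have h1 := one_sub_abs_div_nonneg hT ht
    have := mul_le_mul_of_nonneg_left (cosDef_le_two W t) ha
    exact mul_le_mul_of_nonneg_left (Real.exp_le_exp.mpr (by linarith)) h1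
  rw [intervalIntegral.integral_mul_const, integral_tri hT] at this
  have h := mul_pos hT (Real.exp_pos (-a * 2))
  rw [triMean]
  have : 0 < ∫ t in (-T)..T, (1 - |t| / T) * Real.exp (-a * cosDef W t) := by linarith
  positivity

lemma triMean_continuous (W : Measure ℝ) [IsProbabilityMeasure W] (T : ℝ) :
    Continuous (triMean W T) := by
  have hc := cosDef_continuous W
  unfold triMean
  refine continuous_const.mul
    (intervalIntegral.continuous_parametric_intervalIntegral_of_continuous' ?_ _ _)
  fun_prop

/-- Esseen's inequality. -/
lemma measure_closedBall_le {W D : Measure ℝ} [IsProbabilityMeasure W] [IsProbabilityMeasure D]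
    {α : ℝ}
    (hD : ∀ t : ℝ, (∫ x, Complex.exp (t * x * Complex.I) ∂D) =
          Complex.exp ((α : ℂ) * ((∫ x, Complex.exp (t * x * Complex.I) ∂W) - 1)))
    {T τ : ℝ} (hT : 0 < T) (hτ : τ * T ≤ 1) (x : ℝ) :
    (D (closedBall x (τ / 2))).toReal ≤ 3 * triMean W T α := by
  have hc := cosDef_continuous W
  have hInt : ∀ (M : Measure ℝ) [IsProbabilityMeasure M] (t : ℝ),
      Integrable (fun y : ℝ => Complex.exp (t * y * Complex.I)) M := by
    intro M _ t
    refine Integrable.of_bound (by fun_prop) 1 (Filter.Eventually.of_forall fun y => ?_)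
    rw [← Complex.ofReal_mul, Complex.norm_exp_ofReal_mul_I]
  have hre : ∀ t : ℝ, (∫ y, Complex.exp (((2 * Real.pi * t : ℝ) : ℂ) * y * Complex.I) ∂W).re - 1
      = - cosDef W t := by
    intro t
    have h1 := integral_re (hInt W (2 * Real.pi * t))
    simp only [RCLike.re_to_complex] at h1
    rw [← h1, cosDef, integral_sub (integrable_const _)]
    · simp only [← Complex.ofReal_mul, Complex.exp_ofReal_mul_I_re]
      simp [mul_assoc]
    · refine Integrable.of_bound (by fun_prop) 1 (Filter.Eventually.of_forall fun y => ?_)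
      exact Real.abs_cos_le_one _
  have hin : ∀ t : ℝ, ∫ y, Real.cos (2 * Real.pi * (y - x) * t) ∂D ≤
      Real.exp (-α * cosDef W t) := by
    intro t
    have h1 : ∀ y : ℝ, Complex.exp (((-(2 * Real.pi * t * x) : ℝ) : ℂ) * Complex.I) *
        Complex.exp (((2 * Real.pi * t : ℝ) : ℂ) * y * Complex.I) =
        Complex.exp (((2 * Real.pi * (y - x) * t : ℝ) : ℂ) * Complex.I) := by
      intro y
      rw [← Complex.exp_add]
      congr 1
      push_cast
      ring
    have h2 := integral_re ((hInt D (2 * Real.pi * t)).const_mul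
      (Complex.exp (((-(2 * Real.pi * t * x) : ℝ) : ℂ) * Complex.I)))
    simp only [RCLike.re_to_complex, h1, Complex.exp_ofReal_mul_I_re] at h2
    simp only [← h1] at h2
    rw [h2, integral_const_mul]
    refine (Complex.re_le_norm _).trans ?_
    rw [norm_mul, Complex.norm_exp_ofReal_mul_I, one_mul, hD, Complex.norm_exp,
      Complex.re_ofReal_mul, Complex.sub_re, Complex.one_re, hre]
    simp
  have hswap : ∫ y, tri T (2 * Real.pi * (y - x)) ∂D =
      ∫ t in (-T)..T, (1 - |t| / T) * ∫ y, Real.cos (2 * Real.pi * (y - x) * t) ∂D := by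
    simp only [tri, ← integral_const_mul]
    refine (intervalIntegral_integral_swap ?_).symm
    have : IsFiniteMeasure (volume.restrict (Set.uIoc (-T) T)) :=
      ⟨by rw [Measure.restrict_apply_univ, Set.uIoc_of_le (by linarith)]
          exact measure_Ioc_lt_top⟩
    refine Integrable.of_bound (Continuous.aestronglyMeasurable (by fun_prop)) 1 ?_
    have h1 : ∀ᵐ z ∂((volume.restrict (Set.uIoc (-T) T)).prod D), z.1 ∈ Set.uIoc (-T) T := by
      refine Measure.quasiMeasurePreserving_fst.ae ?_
      exact ae_restrict_mem measurableSet_uIoc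
    filter_upwards [h1] with z hz
    rw [Set.uIoc_of_le (by linarith)] at hz
    have h2 := one_sub_abs_div_nonneg hT ⟨hz.1.le, hz.2⟩
    have h3 : 0 ≤ |z.1| / T := by positivity
    rw [Function.uncurry, norm_mul, Real.norm_eq_abs, Real.norm_eq_abs, abs_of_nonneg h2]
    have h4 := Real.abs_cos_le_one (2 * Real.pi * (z.2 - x) * z.1)
    have h5 := abs_nonneg (Real.cos (2 * Real.pi * (z.2 - x) * z.1))
    nlinarith
  have htri : Continuous fun y => tri T (2 * Real.pi * (y - x)) := by
    unfold tri
    refine intervalIntegral.continuous_parametric_intervalIntegral_of_continuous' ?_ _ _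
    fun_prop
  have htriI : Integrable (fun y => tri T (2 * Real.pi * (y - x))) D := by
    refine Integrable.of_bound htri.aestronglyMeasurable T (Filter.Eventually.of_forall fun y => ?_)
    rw [Real.norm_of_nonneg (tri_nonneg hT _)]
    exact tri_le hT _
  have hlow : T / 3 * (D (closedBall x (τ / 2))).toReal ≤
      ∫ y, tri T (2 * Real.pi * (y - x)) ∂D := by
    have h1 : ∫ y in closedBall x (τ / 2), T / 3 ∂D ≤
        ∫ y in closedBall x (τ / 2), tri T (2 * Real.pi * (y - x)) ∂D := by
      refine setIntegral_mono_on (integrable_const _) htriI.integrableOn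
        isClosed_closedBall.measurableSet fun y hy => ?_
      apply le_tri hT
      rw [mem_closedBall, Real.dist_eq] at hy
      rw [abs_mul, abs_mul, abs_of_pos hT, abs_of_pos (by positivity : 0 < 2 * Real.pi)]
      have : |y - x| * T ≤ 1 / 2 := by nlinarith
      nlinarith [Real.pi_pos]
    have h2 := setIntegral_le_integral (s := closedBall x (τ / 2)) htriI
      (Filter.Eventually.of_forall fun y => tri_nonneg hT _)
    refine le_trans (le_of_eq ?_) (h1.trans h2)
    simp [Measure.real, mul_comm]
  have hup : ∫ t in (-T)..T, (1 - |t| / T) * ∫ y, Real.cos (2 * Real.pi * (y - x) * t) ∂D ≤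
      ∫ t in (-T)..T, (1 - |t| / T) * Real.exp (-α * cosDef W t) := by
    have hcos : Continuous fun t => ∫ y, Real.cos (2 * Real.pi * (y - x) * t) ∂D := by
      refine continuous_of_dominated (bound := fun _ => 1)
        (fun t => (by fun_prop : Continuous fun y : ℝ =>
          Real.cos (2 * Real.pi * (y - x) * t)).aestronglyMeasurable)
        (fun t => Filter.Eventually.of_forall fun y => Real.abs_cos_le_one _) (by fun_prop)
        (Filter.Eventually.of_forall fun y => by fun_prop)
    apply intervalIntegral.integral_mono_on (by linarith)
      (Continuous.intervalIntegrable (by fun_prop) _ _)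
      (Continuous.intervalIntegrable (by fun_prop) _ _)
    intro t ht
    exact mul_le_mul_of_nonneg_left (hin t) (one_sub_abs_div_nonneg hT ht)
  rw [triMean]
  rw [hswap] at hlow
  have h := hlow.trans hup
  set I := ∫ t in (-T)..T, (1 - |t| / T) * Real.exp (-α * cosDef W t)
  rw [← mul_assoc, mul_one_div, div_mul_eq_mul_div, le_div_iff₀ hT]
  linarith

/-- The choice of a smaller intensity at which the logarithmic derivative is controlled. -/
lemma exists_intensity (W : Measure ℝ) [IsProbabilityMeasure W] {α T : ℝ} (hα : 0 < α)
    (hT : 0 < T) {n : ℕ} (hn : 0 < n) : ∃ a, 0 < a ∧ a ≤ α ∧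
      triMean W T α * √α ^ n ≤ triMean W T a * √a ^ n ∧
      1 / T * ∫ t in (-T)..T, (1 - |t| / T) * Real.exp (-a * cosDef W t) * cosDef W t ≤
        2 * n / a * triMean W T a := by
  have hc := cosDef_continuous W
  have hp := triMean_continuous W T
  obtain ⟨a, ha, hmax⟩ := (isCompact_Icc (a := (0 : ℝ)) (b := α)).exists_isMaxOn
    ⟨α, hα.le, le_rfl⟩ (f := fun a => triMean W T a * √a ^ n)
    (by fun_prop)
  have hα' : triMean W T α * √α ^ n ≤ triMean W T a * √a ^ n := hmax ⟨hα.le, le_rfl⟩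
  have ha0 : 0 < a := by
    rcases ha.1.eq_or_lt with h | h
    · rw [← h, Real.sqrt_zero, zero_pow hn.ne', mul_zero] at hα'
      have := triMean_pos W hT hα.le
      have : 0 < triMean W T α * √α ^ n := by positivity
      linarith
    · exact h
  refine ⟨a, ha0, ha.2, hα', ?_⟩
  set s : ℝ := 1 - 1 / (2 * n) with hs
  have hn' : (1 : ℝ) ≤ n := by exact_mod_cast hn
  have hs0 : 0 ≤ s := by
    rw [hs, sub_nonneg, div_le_one (by positivity)]; linarith
  have hs1 : s ≤ 1 := by
    rw [hs]; have : 0 ≤ 1 / (2 * (n : ℝ)) := by positivity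
    linarith
  have h1 := hmax (⟨by positivity, by nlinarith [ha.2]⟩ : a * s ∈ Set.Icc 0 α)
  simp only [Set.mem_ofPred_eq] at h1
  have hsn : 1 / 2 ≤ √s ^ n := by
    have h2 : s ≤ √s := by
      apply Real.le_sqrt_of_sq_le; nlinarith
    have h3 : 1 + (n : ℝ) * (-(1 / (2 * n))) ≤ (1 + -(1 / (2 * (n : ℝ)))) ^ n := by
      apply one_add_mul_le_pow
      linarith
    calc (1 : ℝ) / 2 = 1 + (n : ℝ) * (-(1 / (2 * n))) := by field_simp; ring
      _ ≤ _ := h3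
      _ = s ^ n := by rw [hs, sub_eq_add_neg]
      _ ≤ √s ^ n := by gcongr
  have h4 : triMean W T (a * s) ≤ 2 * triMean W T a := by
    rw [Real.sqrt_mul ha0.le, mul_pow] at h1
    have h5 : 0 < √a ^ n := by positivity
    have h6 : triMean W T (a * s) * √s ^ n ≤ triMean W T a := by
      refine le_of_mul_le_mul_left ?_ h5
      nlinarith
    have := (triMean_pos W hT (mul_nonneg ha0.le hs0)).le
    nlinarith
  have h5 : triMean W T a + a / (2 * n) * (1 / T * ∫ t in (-T)..T,
      (1 - |t| / T) * Real.exp (-a * cosDef W t) * cosDef W t) ≤ triMean W T (a * s) := by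
    have h6 : ∫ t in (-T)..T, ((1 - |t| / T) * Real.exp (-a * cosDef W t) + a / (2 * n) *
        ((1 - |t| / T) * Real.exp (-a * cosDef W t) * cosDef W t)) ≤
        ∫ t in (-T)..T, (1 - |t| / T) * Real.exp (-(a * s) * cosDef W t) := by
      apply intervalIntegral.integral_mono_on (by linarith)
        (Continuous.intervalIntegrable (by fun_prop) _ _)
        (Continuous.intervalIntegrable (by fun_prop) _ _)
      intro t ht
      have h1 := one_sub_abs_div_nonneg hT ht
      have h2 : Real.exp (-(a * s) * cosDef W t) =
          Real.exp (-a * cosDef W t) * Real.exp (a / (2 * n) * cosDef W t) := by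
        rw [← Real.exp_add]; congr 1; rw [hs]; field_simp; ring
      have h3 := Real.add_one_le_exp (a / (2 * n) * cosDef W t)
      rw [h2]
      have h4 := mul_nonneg h1 (Real.exp_pos (-a * cosDef W t)).le
      nlinarith
    rw [intervalIntegral.integral_add (Continuous.intervalIntegrable (by fun_prop) _ _)
        (Continuous.intervalIntegrable (by fun_prop) _ _),
      intervalIntegral.integral_const_mul] at h6
    unfold triMean
    have hT' : 0 ≤ 1 / T := by positivity
    have := mul_le_mul_of_nonneg_left h6 hT'
    linarith
  have h6 : a / (2 * n) * (1 / T * ∫ t in (-T)..T,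
      (1 - |t| / T) * Real.exp (-a * cosDef W t) * cosDef W t) ≤ triMean W T a := by linarith
  set J := 1 / T * ∫ t in (-T)..T,
      (1 - |t| / T) * Real.exp (-a * cosDef W t) * cosDef W t
  rw [div_mul_eq_mul_div, le_div_iff₀ ha0]
  rw [div_mul_eq_mul_div, div_le_iff₀ (by positivity)] at h6
  linarith

/-- The signed distance to the nearest integer. -/
noncomputable def nerr (y : ℝ) : ℝ := y - round y

lemma measurable_nerr : Measurable nerr := by
  have : nerr = fun y => y - (⌊y + 1 / 2⌋ : ℝ) := by
    funext y; rw [nerr, round_eq]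
  rw [this]
  fun_prop

lemma abs_nerr_le (y : ℝ) : |nerr y| ≤ 1 / 2 := abs_sub_round y

lemma nerr_sq_le (y : ℝ) : nerr y ^ 2 ≤ 1 / 4 := by
  have := abs_nerr_le y
  rw [← sq_abs]
  nlinarith [abs_nonneg (nerr y)]

lemma cos_nerr (y : ℝ) : Real.cos (2 * Real.pi * nerr y) = Real.cos (2 * Real.pi * y) := by
  have : 2 * Real.pi * nerr y = 2 * Real.pi * y - (round y : ℤ) * (2 * Real.pi) := by
    rw [nerr]; ring
  rw [this, Real.cos_sub_int_mul_two_pi]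

lemma eight_nerr_sq_le (y : ℝ) : 8 * nerr y ^ 2 ≤ 1 - Real.cos (2 * Real.pi * y) := by
  rw [← cos_nerr]
  have h : |2 * Real.pi * nerr y| ≤ Real.pi := by
    rw [abs_mul, abs_of_pos (by positivity : 0 < 2 * Real.pi)]
    nlinarith [abs_nerr_le y, Real.pi_pos]
  have := Real.cos_le_one_sub_mul_cos_sq h
  have h2 : 2 / Real.pi ^ 2 * (2 * Real.pi * nerr y) ^ 2 = 8 * nerr y ^ 2 := by
    field_simp; ring
  linarith

lemma nerr_sq_integrable {M : Measure ℝ} [IsFiniteMeasure M] {f : ℝ → ℝ} (hf : Measurable f) :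
    Integrable (fun x => nerr (f x) ^ 2) M := by
  refine Integrable.of_bound ((measurable_nerr.comp hf).pow_const 2).aestronglyMeasurable (1 / 4)
    (Filter.Eventually.of_forall fun x => ?_)
  rw [Real.norm_of_nonneg (sq_nonneg _)]
  exact nerr_sq_le _

lemma nerr_sq_integrable_prod {M N : Measure ℝ} [IsFiniteMeasure M] [IsFiniteMeasure N] :
    Integrable (fun z : ℝ × ℝ => nerr (z.1 * z.2) ^ 2) (M.prod N) := by
  refine Integrable.of_bound ((measurable_nerr.comp (by fun_prop)).pow_const 2).aestronglyMeasurable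
    (1 / 4) (Filter.Eventually.of_forall fun x => ?_)
  rw [Real.norm_of_nonneg (sq_nonneg _)]
  exact nerr_sq_le _

/-- The tilted frequency measure. -/
lemma exists_tilt (W : Measure ℝ) [IsProbabilityMeasure W] {a T : ℝ} (ha : 0 < a)
    (hT : 0 < T) {n : ℕ} (h : 1 / T * ∫ t in (-T)..T, (1 - |t| / T) *
      Real.exp (-a * cosDef W t) * cosDef W t ≤ 2 * n / a * triMean W T a) :
    ∃ ν : Measure ℝ, IsProbabilityMeasure ν ∧
      ν ≤ ENNReal.ofReal (1 / (triMean W T a * T)) • (volume.restrict (Set.Icc (-T) T)) ∧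
      ∫ t, ∫ x, nerr (t * x) ^ 2 ∂W ∂ν ≤ n / (4 * a) := by
  have hc := cosDef_continuous W
  have hp := triMean_pos W hT ha.le
  set p := triMean W T a with hpdef
  set g : ℝ → ℝ := fun t => 1 / (p * T) * ((1 - |t| / T) * Real.exp (-a * cosDef W t)) with hg
  have hgc : Continuous g := by fun_prop
  have hg0 : ∀ t ∈ Set.Icc (-T) T, 0 ≤ g t := fun t ht => by
    have := one_sub_abs_div_nonneg hT ht
    simp only [hg]
    positivity
  have hg0' : ∀ᵐ t ∂(volume.restrict (Set.Icc (-T) T)), 0 ≤ g t :=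
    (ae_restrict_mem measurableSet_Icc).mono hg0
  have hg1 : ∀ t ∈ Set.Icc (-T) T, g t ≤ 1 / (p * T) := fun t ht => by
    have h1 := one_sub_abs_div_nonneg hT ht
    have h2 : Real.exp (-a * cosDef W t) ≤ 1 := by
      rw [Real.exp_le_one_iff]
      nlinarith [mul_nonneg ha.le (cosDef_nonneg W t)]
    have h3 : 0 ≤ |t| / T := by positivity
    simp only [hg]
    have h4 := Real.exp_pos (-a * cosDef W t)
    have : (1 - |t| / T) * Real.exp (-a * cosDef W t) ≤ 1 := by nlinarith
    have h5 : 0 ≤ 1 / (p * T) := by positivity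
    nlinarith
  have hgi : ∫ t in Set.Icc (-T) T, g t = 1 := by
    rw [integral_Icc_eq_integral_Ioc, ← intervalIntegral.integral_of_le (by linarith)]
    simp only [hg]
    rw [intervalIntegral.integral_const_mul]
    have : ∫ t in (-T)..T, (1 - |t| / T) * Real.exp (-a * cosDef W t) = p * T := by
      rw [hpdef, triMean]; field_simp
    rw [this]
    field_simp
  set ν := (volume.restrict (Set.Icc (-T) T)).withDensity (fun t => ENNReal.ofReal (g t)) with hν
  have hprob : IsProbabilityMeasure ν := by
    refine ⟨?_⟩
    rw [hν, withDensity_apply _ MeasurableSet.univ, Measure.restrict_univ,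
      ← ofReal_integral_eq_lintegral_ofReal hgc.integrableOn_Icc hg0', hgi]
    simp
  refine ⟨ν, hprob, ?_, ?_⟩
  · rw [← withDensity_const]
    refine withDensity_mono ?_
    filter_upwards [ae_restrict_mem measurableSet_Icc] with t ht
    exact ENNReal.ofReal_le_ofReal (hg1 t ht)
  · have h1 : ∫ t, cosDef W t ∂ν ≤ 2 * n / a := by
      rw [hν, integral_withDensity_eq_integral_toReal_smul (by fun_prop)
        (Filter.Eventually.of_forall fun t => ENNReal.ofReal_lt_top)]
      have h2 : ∫ t in Set.Icc (-T) T, (ENNReal.ofReal (g t)).toReal • cosDef W t =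
          ∫ t in Set.Icc (-T) T, 1 / (p * T) *
            ((1 - |t| / T) * Real.exp (-a * cosDef W t) * cosDef W t) := by
        refine setIntegral_congr_fun measurableSet_Icc fun t ht => ?_
        simp only [smul_eq_mul]
        rw [ENNReal.toReal_ofReal (hg0 t ht)]
        simp only [hg]; ring
      rw [h2, integral_Icc_eq_integral_Ioc, ← intervalIntegral.integral_of_le (by linarith),
        intervalIntegral.integral_const_mul]
      set J := ∫ t in (-T)..T, (1 - |t| / T) * Real.exp (-a * cosDef W t) * cosDef W t
      calc 1 / (p * T) * J = 1 / p * (1 / T * J) := by field_simp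
        _ ≤ 1 / p * (2 * n / a * p) := by gcongr
        _ = 2 * n / a := by field_simp
    have h3 : ∫ t, ∫ x, nerr (t * x) ^ 2 ∂W ∂ν ≤ ∫ t, 1 / 8 * cosDef W t ∂ν := by
      apply integral_mono
      · exact nerr_sq_integrable_prod.integral_prod_left
      · refine Integrable.of_bound (by fun_prop) 1 (Filter.Eventually.of_forall fun t => ?_)
        have := cosDef_nonneg W t
        have := cosDef_le_two W t
        rw [Real.norm_of_nonneg (by positivity)]
        linarith
      · intro t
        simp only [cosDef]
        rw [← integral_const_mul]
        apply integral_mono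
        · exact nerr_sq_integrable (by fun_prop)
        · refine Integrable.of_bound (by fun_prop) 1 (Filter.Eventually.of_forall fun x => ?_)
          have := Real.cos_le_one (2 * Real.pi * (t * x))
          have := Real.neg_one_le_cos (2 * Real.pi * (t * x))
          rw [Real.norm_eq_abs, abs_le]
          constructor <;> linarith
        · intro x
          have := eight_nerr_sq_le (t * x)
          simp only
          linarith
    rw [integral_const_mul] at h3
    refine h3.trans ?_
    calc 1 / 8 * ∫ t, cosDef W t ∂ν ≤ 1 / 8 * (2 * n / a) := by gcongr
      _ = n / (4 * a) := by field_simp; ring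

/-- The real vector with given integer coordinates. -/
def intVec {d : ℕ} (k : Fin d → ℤ) : Fin d → ℝ := fun i => (k i : ℝ)

/-- The points of `Λ` in the half-open unit cube. -/
def cell {d : ℕ} (Λ : Submodule ℤ (Fin d → ℝ)) : Set (Fin d → ℝ) :=
  {c | c ∈ Λ ∧ ∀ i, 0 ≤ c i ∧ c i < 1}

/-- The points of `Λ` in the cube `[-1, 1]^d`. -/
def cube {d : ℕ} (Λ : Submodule ℤ (Fin d → ℝ)) : Set (Fin d → ℝ) :=
  {c | c ∈ Λ ∧ ∀ i, |c i| ≤ 1}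

/-- `Λ` lies between `ℤ^d` and `N⁻¹ ℤ^d`. -/
structure IsOverlattice {d : ℕ} (N : ℤ) (Λ : Submodule ℤ (Fin d → ℝ)) : Prop where
  intVec_mem : ∀ k : Fin d → ℤ, intVec k ∈ Λ
  denom : ∀ c ∈ Λ, ∀ i, ∃ k : ℤ, (N : ℝ) * c i = k

section lattice

variable {d : ℕ} {N : ℤ} {Λ : Submodule ℤ (Fin d → ℝ)}

lemma finite_of_denom (hN : N ≠ 0) {S : Set (Fin d → ℝ)} {R : ℝ}
    (h : ∀ c ∈ S, ∀ i, ∃ k : ℤ, (N : ℝ) * c i = k) (hR : ∀ c ∈ S, ∀ i, |c i| ≤ R) :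
    S.Finite := by
  have hN' : (N : ℝ) ≠ 0 := by exact_mod_cast hN
  choose! k hk using h
  have hinj : Set.InjOn k S := by
    intro c hc c' hc' hcc
    funext i
    have h1 := hk c hc i
    rw [hcc, ← hk c' hc' i] at h1
    exact mul_left_cancel₀ hN' h1
  refine Set.Finite.of_finite_image ?_ hinj
  refine (Set.Finite.pi' (ι := Fin d)
    (t := fun _ => Set.Icc (-⌈|(N : ℝ)| * R⌉) ⌈|(N : ℝ)| * R⌉) fun _ => Set.finite_Icc _ _).subset ?_
  rintro _ ⟨c, hc, rfl⟩ i
  have h1 : |((k c i : ℤ) : ℝ)| ≤ |(N : ℝ)| * R := by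
    rw [← hk c hc i, abs_mul]
    gcongr
    exact hR c hc i
  have h2 := h1.trans (Int.le_ceil _)
  rw [abs_le] at h2
  constructor
  · exact_mod_cast h2.1
  · exact_mod_cast h2.2

lemma IsOverlattice.cell_finite (h : IsOverlattice N Λ) (hN : N ≠ 0) : (cell Λ).Finite :=
  finite_of_denom (R := 1) hN (fun c hc => h.denom c hc.1) fun c hc i => by
    rw [abs_of_nonneg (hc.2 i).1]; exact (hc.2 i).2.le

lemma IsOverlattice.cube_finite (h : IsOverlattice N Λ) (hN : N ≠ 0) : (cube Λ).Finite :=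
  finite_of_denom (R := 1) hN (fun c hc => h.denom c hc.1) fun _ hc => hc.2

lemma zero_mem_cell : (0 : Fin d → ℝ) ∈ cell Λ := ⟨Λ.zero_mem, fun i => by simp⟩

lemma IsOverlattice.ncard_cell_pos (h : IsOverlattice N Λ) (hN : N ≠ 0) : 0 < (cell Λ).ncard :=
  (Set.ncard_pos (h.cell_finite hN)).mpr ⟨0, zero_mem_cell⟩

lemma IsOverlattice.fract_mem_cell (h : IsOverlattice N Λ) {c : Fin d → ℝ} (hc : c ∈ Λ) :
    (fun i => Int.fract (c i)) ∈ cell Λ := by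
  refine ⟨?_, fun i => ⟨Int.fract_nonneg _, Int.fract_lt_one _⟩⟩
  have : (fun i => Int.fract (c i)) = c - intVec fun i => ⌊c i⌋ := by
    funext i; simp only [intVec, Pi.sub_apply, Int.self_sub_floor]
  rw [this]
  exact Λ.sub_mem hc (h.intVec_mem _)

lemma IsOverlattice.ncard_cube_le (h : IsOverlattice N Λ) (hN : N ≠ 0) :
    (cube Λ).ncard ≤ 3 ^ d * (cell Λ).ncard := by
  set F : Set (Fin d → ℤ) := ↑(Fintype.piFinset fun _ : Fin d => Finset.Icc (-1 : ℤ) 1) with hF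
  have hFc : F.ncard = 3 ^ d := by
    rw [hF, Set.ncard_coe_finset, Fintype.card_piFinset]
    simp
  rw [← hFc, ← Set.ncard_prod]
  refine Set.ncard_le_ncard_of_injOn (fun c => (fun i => ⌊c i⌋, fun i => Int.fract (c i))) ?_ ?_
    ((Finset.finite_toSet _).prod (h.cell_finite hN))
  · intro c hc
    refine ⟨?_, h.fract_mem_cell hc.1⟩
    rw [hF, Finset.mem_coe, Fintype.mem_piFinset]
    intro i
    have := abs_le.mp (hc.2 i)
    rw [Finset.mem_Icc]
    have h2 : ⌊c i⌋ < 2 := by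
      rw [Int.floor_lt]; push_cast; linarith
    exact ⟨by rw [Int.le_floor]; push_cast; exact this.1, by simp only; omega⟩
  · intro c _ c' _ hcc
    simp only [Prod.mk.injEq] at hcc
    funext i
    rw [← Int.floor_add_fract (c i), ← Int.floor_add_fract (c' i), congrFun hcc.1 i,
      congrFun hcc.2 i]

lemma IsOverlattice.exists_nsmul_eq_intVec (h : IsOverlattice N Λ) (hN : N ≠ 0)
    {c : Fin d → ℝ} (hc : c ∈ Λ) :
    ∃ l : ℕ, 1 ≤ l ∧ l ≤ (cell Λ).ncard ∧ ∀ i, ∃ k : ℤ, (l : ℝ) * c i = k := by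
  have hmaps : ∀ j ∈ Finset.range ((cell Λ).ncard + 1),
      (fun i => Int.fract ((j : ℝ) * c i)) ∈ (h.cell_finite hN).toFinset := by
    intro j _
    rw [Set.Finite.mem_toFinset]
    have : (fun i => (j : ℝ) * c i) ∈ Λ := by
      have := Λ.nsmul_mem hc j
      have heq : (fun i => (j : ℝ) * c i) = j • c := by funext i; simp
      rw [heq]; exact this
    exact h.fract_mem_cell this
  obtain ⟨j, hj, j', hj', hne, heq⟩ := Finset.exists_ne_map_eq_of_card_lt_of_maps_to (by
    rw [← Set.ncard_eq_toFinset_card _ (h.cell_finite hN)]; simp) hmaps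
  wlog hlt : j < j' generalizing j j'
  · exact this j' hj' j hj hne.symm heq.symm (by omega)
  refine ⟨j' - j, by omega, by rw [Finset.mem_range] at hj'; omega, fun i => ?_⟩
  have := congrFun heq.symm i
  simp only [Int.fract_eq_fract] at this
  obtain ⟨z, hz⟩ := this
  exact ⟨z, by rw [← hz, Nat.cast_sub hlt.le]; ring⟩

lemma IsOverlattice.exists_factorial_mul (h : IsOverlattice N Λ) (hN : N ≠ 0)
    {m : ℕ} (hm : (cell Λ).ncard ≤ m) {c : Fin d → ℝ} (hc : c ∈ Λ) (i : Fin d) :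
    ∃ k : ℤ, (m.factorial : ℝ) * c i = k := by
  obtain ⟨l, hl1, hl2, hl⟩ := h.exists_nsmul_eq_intVec hN hc
  obtain ⟨k, hk⟩ := hl i
  obtain ⟨q, hq⟩ := Nat.dvd_factorial hl1 (hl2.trans hm)
  exact ⟨q * k, by rw [hq]; push_cast; rw [← hk]; ring⟩

/-- Translates of the cell fill the cube `[0, J)^d`. -/
lemma IsOverlattice.exists_box (h : IsOverlattice N Λ) (hN : N ≠ 0) (J : ℕ) :
    ∃ S : Finset (Fin d → ℝ), (∀ c ∈ S, c ∈ Λ ∧ ∀ i, 0 ≤ c i ∧ c i ≤ J) ∧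
      #S = J ^ d * (cell Λ).ncard := by
  classical
  set P := (Fintype.piFinset fun _ : Fin d => Finset.range J) ×ˢ (h.cell_finite hN).toFinset
  refine ⟨P.image fun p i => (p.1 i : ℝ) + p.2 i, ?_, ?_⟩
  · intro c hc
    obtain ⟨⟨k, v⟩, hp, rfl⟩ := Finset.mem_image.mp hc
    rw [Finset.mem_product, Fintype.mem_piFinset, Set.Finite.mem_toFinset] at hp
    refine ⟨?_, fun i => ?_⟩
    · have := Λ.add_mem (h.intVec_mem fun i => (k i : ℤ)) hp.2.1
      have heq : (intVec fun i => (k i : ℤ)) + v = fun i => (k i : ℝ) + v i := by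
        funext i; simp [intVec]
      rw [heq] at this; exact this
    · have h1 := hp.2.2 i
      have h2 := Finset.mem_range.mp (hp.1 i)
      have h3 : ((k i : ℕ) : ℝ) + 1 ≤ J := by exact_mod_cast h2
      have h4 : (0 : ℝ) ≤ k i := by positivity
      simp only at h1 h3 h4 ⊢
      constructor <;> linarith
  · rw [Finset.card_image_of_injOn]
    · rw [Finset.card_product, Fintype.card_piFinset, Set.ncard_eq_toFinset_card _ (h.cell_finite hN)]
      simp
    · rintro ⟨k, v⟩ hp ⟨k', v'⟩ hp' heq
      rw [Finset.mem_coe, Finset.mem_product, Fintype.mem_piFinset, Set.Finite.mem_toFinset] at hp hp'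
      have key : ∀ i, k i = k' i ∧ v i = v' i := by
        intro i
        have h1 := congrFun heq i
        have h2 := hp.2.2 i
        have h3 := hp'.2.2 i
        simp only at h1 h2 h3
        have h4 : ⌊(k i : ℝ) + v i⌋ = ⌊(k' i : ℝ) + v' i⌋ := by rw [h1]
        rw [Int.floor_natCast_add, Int.floor_natCast_add, Int.floor_eq_zero_iff.mpr h2,
          Int.floor_eq_zero_iff.mpr h3] at h4
        have h5 : k i = k' i := by omega
        rw [h5] at h1
        exact ⟨h5, by linarith⟩
      rw [Prod.mk.injEq]
      exact ⟨funext fun i => (key i).1, funext fun i => (key i).2⟩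

lemma IsOverlattice.sup_span (h : IsOverlattice N Λ) {c : Fin d → ℝ}
    (hc : ∀ i, ∃ k : ℤ, (N : ℝ) * c i = k) : IsOverlattice N (Λ ⊔ Submodule.span ℤ {c}) := by
  refine ⟨fun k => Submodule.mem_sup_left (h.intVec_mem k), fun v hv i => ?_⟩
  obtain ⟨y, hy, z, hz, rfl⟩ := Submodule.mem_sup.mp hv
  obtain ⟨q, rfl⟩ := Submodule.mem_span_singleton.mp hz
  obtain ⟨k, hk⟩ := h.denom y hy i
  obtain ⟨k', hk'⟩ := hc i
  refine ⟨k + q * k', ?_⟩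
  rw [Pi.add_apply, Pi.smul_apply, zsmul_eq_mul]
  push_cast
  rw [← hk, ← hk']
  ring

/-- Adjoining a vector of order `l` modulo `Λ` multiplies the index by at least `l`. -/
lemma IsOverlattice.mul_ncard_cell_le (h : IsOverlattice N Λ) (hN : N ≠ 0) {c : Fin d → ℝ}
    (hc : ∀ i, ∃ k : ℤ, (N : ℝ) * c i = k) {l : ℕ}
    (hl : ∀ j : ℕ, 0 < j → j < l → (j : ℤ) • c ∉ Λ) :
    l * (cell Λ).ncard ≤ (cell (Λ ⊔ Submodule.span ℤ {c})).ncard := by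
  have h' := h.sup_span hc
  have h1 : l * (cell Λ).ncard = ((Finset.range l : Set ℕ) ×ˢ cell Λ).ncard := by
    rw [Set.ncard_prod, Set.ncard_coe_finset, Finset.card_range]
  rw [h1]
  refine Set.ncard_le_ncard_of_injOn (fun p i => Int.fract (((p.1 : ℤ) • c + p.2) i)) ?_ ?_
    (h'.cell_finite hN)
  · rintro ⟨j, v⟩ hp
    refine h'.fract_mem_cell ?_
    rw [add_comm]
    exact Submodule.add_mem_sup hp.2.1 (Submodule.smul_mem _ _ (Submodule.mem_span_singleton_self c))
  · rintro ⟨j, v⟩ hp ⟨j', v'⟩ hp' heq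
    have hz : ∀ i, ∃ z : ℤ, ((j : ℤ) • c + v) i - ((j' : ℤ) • c + v') i = z := fun i => by
      have := congrFun heq i
      exact Int.fract_eq_fract.mp this
    choose z hz using hz
    have hzΛ : (j : ℤ) • c + v - ((j' : ℤ) • c + v') ∈ Λ := by
      have : (j : ℤ) • c + v - ((j' : ℤ) • c + v') = intVec z := by
        funext i; rw [intVec, ← hz]; rfl
      rw [this]; exact h.intVec_mem z
    have hdiff : ((j : ℤ) - j') • c ∈ Λ := by
      have := Λ.add_mem (Λ.sub_mem hzΛ hp.2.1) hp'.2.1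
      convert this using 1
      rw [sub_smul]; abel
    have hjl : j < l := by simpa using hp.1
    have hjl' : j' < l := by simpa using hp'.1
    have hjj : j = j' := by
      by_contra hne
      rcases lt_or_gt_of_ne hne with hlt | hlt
      · refine hl (j' - j) (by omega) (by omega) ?_
        have := Λ.neg_mem hdiff
        rw [← neg_smul] at this
        convert this using 2
        omega
      · refine hl (j - j') (by omega) (by omega) ?_
        convert hdiff using 2
        omega
    subst hjj
    rw [Prod.mk.injEq]
    refine ⟨rfl, funext fun i => ?_⟩
    have h2 := hp.2.2 i
    have h3 := hp'.2.2 i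
    have h4 := hz i
    simp only [Pi.add_apply] at h4 h2 h3
    have h5 : v i - v' i = z i := by linarith
    have h6 : z i = 0 := by
      have : ((z i : ℤ) : ℝ) < 1 := by linarith
      have h7 : (-1 : ℝ) < z i := by linarith
      have h8 : z i < 1 := by exact_mod_cast this
      have h9 : -1 < z i := by exact_mod_cast h7
      omega
    rw [h6, Int.cast_zero] at h5
    linarith

lemma IsOverlattice.discreteTopology (h : IsOverlattice N Λ) (hN : N ≠ 0) :
    DiscreteTopology Λ := by
  have hN' : 0 < |(N : ℝ)| := abs_pos.mpr (by exact_mod_cast hN)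
  refine discreteTopology_iff_isOpen_singleton_zero.mpr ?_
  refine ⟨Metric.ball 0 (1 / |(N : ℝ)|), Metric.isOpen_ball, ?_⟩
  ext ⟨x, hx⟩
  simp only [Set.mem_preimage, mem_ball_zero_iff, Set.mem_singleton_iff, Submodule.mk_eq_zero]
  constructor
  · intro hlt
    funext i
    obtain ⟨k, hk⟩ := h.denom x hx i
    have h1 : |x i| < 1 / |(N : ℝ)| := (norm_le_pi_norm x i).trans_lt hlt
    rw [lt_div_iff₀ hN', ← abs_mul, mul_comm, hk] at h1
    have h2 : k = 0 := by
      have : |k| < 1 := by exact_mod_cast h1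
      exact Int.abs_lt_one_iff.mp this
    rw [h2, Int.cast_zero] at hk
    simpa [hN] using hk
  · rintro rfl
    simpa using hN'

/-- The image of the cube of an overlattice under a linear form is a CGAP. -/
lemma IsOverlattice.isCGAP (h : IsOverlattice N Λ) (hN : N ≠ 0) {m : ℕ}
    (hm : 3 ^ d * (cell Λ).ncard ≤ m) (x : Fin d → ℝ) :
    IsCGAP d m ((fun c => ∑ i, c i * x i) '' cube Λ) := by
  have := h.discreteTopology hN
  have hspan : IsZLattice ℝ Λ := by
    refine ⟨?_⟩
    rw [eq_top_iff, ← (Pi.basisFun ℝ (Fin d)).span_eq]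
    refine Submodule.span_mono ?_
    rintro _ ⟨i, rfl⟩
    have heq : Pi.basisFun ℝ (Fin d) i = intVec (Pi.single i 1) := by
      funext j
      simp [intVec, Pi.single_apply]
    rw [heq]
    exact h.intVec_mem (Pi.single i 1)
  set b : Module.Basis (Fin d) ℤ Λ := IsZLattice.basis Λ
  set g : (Fin d → ℝ) → (Fin d → ℝ) := fun v => ∑ i, v i • (b i : Fin d → ℝ) with hg
  have hgl : ∀ v : Fin d → ℤ, g (intVec v) = ((∑ i, v i • b i : Λ) : Fin d → ℝ) := by
    intro v
    rw [Submodule.coe_sum]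
    simp only [hg, intVec]
    refine Finset.sum_congr rfl fun i _ => ?_
    rw [Submodule.coe_smul, Int.cast_smul_eq_zsmul]
  have hgmem : ∀ v : Fin d → ℤ, g (intVec v) ∈ Λ := fun v => by
    rw [hgl]; exact SetLike.coe_mem _
  have hginj : Function.Injective fun v : Fin d → ℤ => g (intVec v) := by
    intro v v' hvv
    simp only [hgl] at hvv
    have h1 := Subtype.coe_injective hvv
    rw [← b.equivFun_symm_apply, ← b.equivFun_symm_apply] at h1
    exact b.equivFun.symm.injective h1
  have hgsurj : ∀ c ∈ Λ, ∃ v : Fin d → ℤ, g (intVec v) = c := by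
    intro c hc
    refine ⟨fun i => b.repr ⟨c, hc⟩ i, ?_⟩
    rw [hgl, b.sum_repr]
  have hgc : Continuous g := by fun_prop
  set V : Set (Fin d → ℝ) := {v | ∀ j, |g v j| ≤ 1} with hV
  have hSV : ∀ v : Fin d → ℤ, (fun i => (v i : ℝ)) ∈ V ↔ g (intVec v) ∈ cube Λ := fun v =>
    ⟨fun hv => ⟨hgmem v, hv⟩, fun hv => hv.2⟩
  have himg : (fun v : Fin d → ℤ => g (intVec v)) '' {v | (fun i => (v i : ℝ)) ∈ V} = cube Λ := by
    ext c
    constructor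
    · rintro ⟨v, hv, rfl⟩
      exact (hSV v).mp hv
    · intro hc
      obtain ⟨v, rfl⟩ := hgsurj c hc.1
      exact ⟨v, (hSV v).mpr hc, rfl⟩
  refine ⟨fun i => ∑ j, (b i : Fin d → ℝ) j * x j, V, ?_, ?_, ?_, ?_, ?_, ?_⟩
  · have : V = ⋂ j, {v | |g v j| ≤ 1} := by ext v; simp [hV]
    rw [this]
    exact isClosed_iInter fun j => isClosed_le (by fun_prop) continuous_const
  · have hadd : ∀ (a b : ℝ) (v w : Fin d → ℝ), g (a • v + b • w) = a • g v + b • g w := by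
      intro a b v w
      simp only [hg, Pi.add_apply, Pi.smul_apply, add_smul, Finset.sum_add_distrib, smul_eq_mul,
        mul_smul, Finset.smul_sum]
    intro v hv w hw a b ha hb hab j
    rw [hadd, Pi.add_apply, Pi.smul_apply, Pi.smul_apply, smul_eq_mul, smul_eq_mul]
    have h1 := abs_le.mp (hv j)
    have h2 := abs_le.mp (hw j)
    rw [abs_le]
    constructor <;> nlinarith
  · intro v hv j
    have : g (-v) = -g v := by simp [hg]
    rw [this, Pi.neg_apply, abs_neg]
    exact hv j
  · refine Set.Finite.of_finite_image ?_ hginj.injOn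
    rw [himg]
    exact h.cube_finite hN
  · rw [← Set.ncard_image_of_injective _ hginj, himg]
    exact (h.ncard_cube_le hN).trans hm
  · rw [← himg, Set.image_image]
    refine Set.image_congr fun v _ => ?_
    simp only [hg, intVec, Finset.sum_apply, Pi.smul_apply, smul_eq_mul, Finset.sum_mul,
      Finset.mul_sum]
    rw [Finset.sum_comm]
    refine Finset.sum_congr rfl fun i _ => Finset.sum_congr rfl fun j _ => ?_
    ring

end lattice

/-- Thickening a CGAP by a symmetric progression raises its rank by one. -/
lemma IsCGAP.succ {r m : ℕ} {K : Set ℝ} (h : IsCGAP r m K) (τ : ℝ) (j : ℕ) :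
    IsCGAP (r + 1) (m * (2 * j + 1))
      {y | ∃ z ∈ K, ∃ i : ℤ, |i| ≤ j ∧ y = z + i * τ} := by
  obtain ⟨a, V, hcl, hcv, hsym, hfin, hcard, rfl⟩ := h
  set V' : Set (Fin (r + 1) → ℝ) := {v | (fun i => v (Fin.castSucc i)) ∈ V ∧ |v (Fin.last r)| ≤ j}
    with hV'
  set S : Set (Fin r → ℤ) := {ν | (fun i => (ν i : ℝ)) ∈ V} with hS
  set S' : Set (Fin (r + 1) → ℤ) := {ν | (fun i => (ν i : ℝ)) ∈ V'} with hS'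
  have hmem : ∀ ν : Fin (r + 1) → ℤ, ν ∈ S' ↔
      (fun i => ν (Fin.castSucc i)) ∈ S ∧ |ν (Fin.last r)| ≤ j := by
    intro ν
    have : |((ν (Fin.last r) : ℤ) : ℝ)| ≤ j ↔ |ν (Fin.last r)| ≤ (j : ℤ) := by
      rw [← Int.cast_abs]; exact_mod_cast Iff.rfl
    rw [← this]; rfl
  set f : (Fin (r + 1) → ℤ) → (Fin r → ℤ) × ℤ := fun ν => (fun i => ν (Fin.castSucc i), ν (Fin.last r))
  have hf : Function.Injective f := by
    intro ν ν' hνν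
    simp only [f, Prod.mk.injEq] at hνν
    funext i
    refine Fin.lastCases hνν.2 (fun i => congrFun hνν.1 i) i
  have hmaps : Set.MapsTo f S' (S ×ˢ (Set.Icc (-(j : ℤ)) j)) := by
    intro ν hν
    have := (hmem ν).mp hν
    exact ⟨this.1, abs_le.mp this.2⟩
  have hfinp : (S ×ˢ (Set.Icc (-(j : ℤ)) j)).Finite := hfin.prod (Set.finite_Icc _ _)
  refine ⟨Fin.snoc a τ, V', ?_, ?_, ?_, ?_, ?_, ?_⟩
  · exact (hcl.preimage (f := fun v : Fin (r + 1) → ℝ => fun i => v (Fin.castSucc i))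
      (by fun_prop)).inter
      (isClosed_le (f := fun v : Fin (r + 1) → ℝ => |v (Fin.last r)|) (by fun_prop)
        continuous_const)
  · intro v hv w hw p q hp hq hpq
    refine ⟨hcv hv.1 hw.1 hp hq hpq, ?_⟩
    have h1 := abs_le.mp hv.2
    have h2 := abs_le.mp hw.2
    rw [Pi.add_apply, Pi.smul_apply, Pi.smul_apply, smul_eq_mul, smul_eq_mul, abs_le]
    constructor <;> nlinarith
  · intro v hv
    exact ⟨hsym _ hv.1, by rw [Pi.neg_apply, abs_neg]; exact hv.2⟩
  · exact Set.Finite.of_injOn hmaps hf.injOn hfinp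
  · calc S'.ncard ≤ (S ×ˢ (Set.Icc (-(j : ℤ)) j)).ncard :=
          Set.ncard_le_ncard_of_injOn f hmaps hf.injOn hfinp
      _ = S.ncard * (2 * j + 1) := by
          rw [Set.ncard_prod, ← Finset.coe_Icc, Set.ncard_coe_finset, Int.card_Icc]
          congr 1; omega
      _ ≤ m * (2 * j + 1) := by gcongr
  · ext y
    constructor
    · rintro ⟨z, ⟨ν, hν, rfl⟩, i, hi, rfl⟩
      refine ⟨Fin.snoc ν i, (hmem _).mpr ⟨?_, ?_⟩, ?_⟩
      · simpa using hν
      · simpa using hi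
      · simp [Fin.sum_univ_castSucc]
    · rintro ⟨ν, hν, rfl⟩
      have := (hmem ν).mp hν
      refine ⟨_, ⟨_, this.1, rfl⟩, ν (Fin.last r), this.2, ?_⟩
      simp [Fin.sum_univ_castSucc]

lemma IsCGAP.mono_card {r m m' : ℕ} {K : Set ℝ} (h : IsCGAP r m K) (hm : m ≤ m') :
    IsCGAP r m' K := by
  obtain ⟨a, V, hcl, hcv, hsym, hfin, hcard, hK⟩ := h
  exact ⟨a, V, hcl, hcv, hsym, hfin, hcard.trans hm, hK⟩

lemma IsCGAP.mono_rank {r r' m : ℕ} {K : Set ℝ} (h : IsCGAP r m K) (hr : r ≤ r') :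
    IsCGAP r' m K := by
  induction r', hr using Nat.le_induction with
  | base => exact h
  | succ r' _ ih =>
    have := ih.succ 0 0
    simpa using this

lemma half_le_integral_cos {ν : Measure ℝ} [IsProbabilityMeasure ν] {z : ℝ} {B : Set ℝ}
    (hB : ν.real B ≤ 1 / 10) (h : ∀ t ∉ B, ∃ q : ℤ, |t * z - q| ≤ 1 / 8) :
    1 / 2 ≤ ∫ t, Real.cos (2 * Real.pi * (t * z)) ∂ν := by
  set F : Set ℝ := {t | Real.cos (2 * Real.pi * (t * z)) < 0.7} with hF
  have hFm : MeasurableSet F := measurableSet_lt (by fun_prop) measurable_const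
  have hFB : F ⊆ B := by
    intro t ht
    by_contra hB'
    obtain ⟨q, hq⟩ := h t hB'
    rw [hF, Set.mem_ofPred_eq] at ht
    have h1 : Real.cos (2 * Real.pi * (t * z)) = Real.cos |2 * Real.pi * (t * z - q)| := by
      rw [Real.cos_abs, ← Real.cos_sub_int_mul_two_pi (2 * Real.pi * (t * z)) q]
      congr 1; ring
    have h2 : |2 * Real.pi * (t * z - q)| ≤ Real.pi / 4 := by
      rw [abs_mul, abs_of_pos (by positivity : 0 < 2 * Real.pi)]
      nlinarith [Real.pi_pos]
    have h3 : Real.cos (Real.pi / 4) ≤ Real.cos |2 * Real.pi * (t * z - q)| :=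
      Real.cos_le_cos_of_nonneg_of_le_pi (abs_nonneg _) (by linarith [Real.pi_pos]) h2
    rw [Real.cos_pi_div_four] at h3
    have h4 : (1.4 : ℝ) ≤ √2 := Real.le_sqrt_of_sq_le (by norm_num)
    linarith
  have hFr : ν.real F ≤ 1 / 10 := (measureReal_mono hFB).trans hB
  have h1 : ∫ t, (0.7 - 1.7 * F.indicator (fun _ => (1 : ℝ)) t) ∂ν ≤
      ∫ t, Real.cos (2 * Real.pi * (t * z)) ∂ν := by
    have hi : Integrable (F.indicator fun _ => (1 : ℝ)) ν :=
      (integrable_const _).indicator hFm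
    refine integral_mono ((integrable_const _).sub (hi.const_mul _)) ?_ ?_
    · exact Integrable.of_bound (by fun_prop) 1
        (Filter.Eventually.of_forall fun t => Real.abs_cos_le_one _)
    · intro t
      by_cases ht : t ∈ F
      · simp only [Set.indicator_of_mem ht]
        have := Real.neg_one_le_cos (2 * Real.pi * (t * z))
        linarith
      · simp only [Set.indicator_of_notMem ht]
        rw [hF, Set.mem_ofPred_eq, not_lt] at ht
        linarith
  have h2 : ∫ t, (0.7 - 1.7 * F.indicator (fun _ => (1 : ℝ)) t) ∂ν = 0.7 - 1.7 * ν.real F := by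
    rw [integral_sub (integrable_const _)
      (((integrable_const _).indicator hFm).const_mul _), integral_const_mul,
      integral_indicator_const _ hFm]
    simp
  rw [h2] at h1
  linarith

/-- The matrix of nearest integers of the products `t j * x i`. -/
noncomputable def roundMat {d : ℕ} (t x : Fin d → ℝ) : Matrix (Fin d) (Fin d) ℤ :=
  Matrix.of fun j i => round (t j * x i)

/-- The pairing of coefficients with nearest integers. -/
noncomputable def roundPair {d : ℕ} (x c : Fin d → ℝ) (t : ℝ) : ℝ :=
  ∑ i, c i * (round (t * x i) : ℝ)

/-- The frequencies at which the linear structure spanned by `x` over `Λ` is not visible. -/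
def badSet {d : ℕ} (𝒯 : Set ℝ) (θ : ℝ) (x : Fin d → ℝ) (Λ : Submodule ℤ (Fin d → ℝ)) : Set ℝ :=
  {t | ¬ (t ∈ 𝒯 ∧ (∀ i, |nerr (t * x i)| ≤ θ) ∧ ∀ c ∈ Λ, ∃ z : ℤ, roundPair x c t = z)}

lemma abs_mul_sum_sub_roundPair_le {d : ℕ} {x c : Fin d → ℝ} {t θ R : ℝ}
    (hx : ∀ i, |nerr (t * x i)| ≤ θ) (hc : ∀ i, |c i| ≤ R) :
    |t * ∑ i, c i * x i - roundPair x c t| ≤ d * R * θ := by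
  have h : t * ∑ i, c i * x i - roundPair x c t = ∑ i, c i * nerr (t * x i) := by
    rw [roundPair, Finset.mul_sum, ← Finset.sum_sub_distrib]
    refine Finset.sum_congr rfl fun i _ => ?_
    rw [nerr]; ring
  rw [h]
  refine (Finset.abs_sum_le_sum_abs _ _).trans ?_
  refine (Finset.sum_le_card_nsmul _ _ (R * θ) fun i _ => ?_).trans ?_
  · rw [abs_mul]
    exact mul_le_mul (hc i) (hx i) (abs_nonneg _) ((abs_nonneg _).trans (hc i))
  · rw [nsmul_eq_mul, Finset.card_univ, Fintype.card_fin, mul_assoc]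

lemma exists_roundPair_ne_zero {d : ℕ} {t x c : Fin d → ℝ} (hdet : (roundMat t x).det ≠ 0)
    (hc : c ≠ 0) : ∃ j, roundPair x c (t j) ≠ 0 := by
  by_contra! h
  apply hc
  have hdet' : ((roundMat t x).map (Int.castRingHom ℝ)).det ≠ 0 := by
    rw [← RingHom.mapMatrix_apply, ← RingHom.map_det]
    simpa using hdet
  refine Matrix.eq_zero_of_mulVec_eq_zero hdet' ?_
  funext j
  have := h j
  rw [roundPair] at this
  simp only [Matrix.mulVec, dotProduct, Matrix.map_apply, roundMat, Matrix.of_apply, Pi.zero_apply]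
  rw [← this]
  refine Finset.sum_congr rfl fun i _ => ?_
  simp [mul_comm]

/-- Counting lattice points: a structure visible at most frequencies has small size. -/
lemma card_le_of_visible {ν : Measure ℝ} [IsProbabilityMeasure ν] {T M : ℝ} (hT : 0 < T)
    (hsieve : ∀ Z : Finset ℝ, (∀ z ∈ Z, ∀ w ∈ Z, z ≠ w → 1 / (2 * T) ≤ |z - w|) →
      (∀ z ∈ Z, 1 / 2 ≤ ∫ t, Real.cos (2 * Real.pi * (t * z)) ∂ν) → (#Z : ℝ) ≤ M)
    {d : ℕ} {N : ℤ} {Λ : Submodule ℤ (Fin d → ℝ)} (hΛ : IsOverlattice N Λ) (hN : N ≠ 0)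
    {𝒯 : Set ℝ} {t x : Fin d → ℝ} {t₀ θ : ℝ} (ht₀ : 0 < t₀) (ht₀T : t₀ ≤ T)
    (h𝒯 : ∀ s ∈ 𝒯, |s| ≤ t₀) (ht : ∀ j, t j ∈ 𝒯) (herr : ∀ j i, |nerr (t j * x i)| ≤ θ)
    (hdet : (roundMat t x).det ≠ 0)
    (hInt : ∀ c ∈ Λ, ∀ j, ∃ z : ℤ, roundPair x c (t j) = z)
    (hbad : ν.real (badSet 𝒯 θ x Λ) ≤ 1 / 10) {J : ℕ} (hJ : d * J * θ ≤ 1 / 16)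
    {n : ℕ} (hn : ∀ k < n, k / (2 * T) ≤ 1 / (16 * t₀)) :
    ((J ^ d * (cell Λ).ncard * n : ℕ) : ℝ) ≤ M := by
  classical
  obtain ⟨S, hS, hScard⟩ := hΛ.exists_box hN J
  set f : (Fin d → ℝ) × ℕ → ℝ := fun p => ∑ i, p.1 i * x i + p.2 / (2 * T) with hf
  have hk : ∀ k < n, ∀ s, |s| ≤ t₀ → |s| * (k / (2 * T)) ≤ 1 / 16 := by
    intro k hk s hs
    calc |s| * (k / (2 * T)) ≤ t₀ * (1 / (16 * t₀)) :=
          mul_le_mul hs (hn k hk) (by positivity) ht₀.le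
      _ = 1 / 16 := by field_simp
  have hsep : ∀ p ∈ S ×ˢ Finset.range n, ∀ q ∈ S ×ˢ Finset.range n, p ≠ q →
      1 / (2 * T) ≤ |f p - f q| := by
    rintro ⟨c, k⟩ hp ⟨c', k'⟩ hq hne
    rw [Finset.mem_product, Finset.mem_range] at hp hq
    simp only at hp hq
    by_cases hcc : c = c'
    · subst hcc
      have hkk : k ≠ k' := fun h => hne (by rw [h])
      have h1 : (1 : ℝ) ≤ |(k : ℝ) - k'| := by
        have : (1 : ℤ) ≤ |(k : ℤ) - k'| := Int.one_le_abs (by omega)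
        exact_mod_cast this
      have h2 : f (c, k) - f (c, k') = ((k : ℝ) - k') / (2 * T) := by simp only [hf]; ring
      rw [h2, abs_div, abs_of_pos (by positivity : 0 < 2 * T)]
      gcongr
    · obtain ⟨j, hj⟩ := exists_roundPair_ne_zero hdet (sub_ne_zero.mpr hcc)
      obtain ⟨z, hz⟩ := hInt _ (Λ.sub_mem (hS c hp.1).1 (hS c' hq.1).1) j
      have hz1 : (1 : ℝ) ≤ |roundPair x (c - c') (t j)| := by
        rw [hz] at hj ⊢
        have h0 : z ≠ 0 := by rintro rfl; simp at hj
        exact_mod_cast Int.one_le_abs h0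
      have h1 := abs_mul_sum_sub_roundPair_le (R := J) (c := c - c') (herr j) (fun i => by
        have h2 := (hS c hp.1).2 i
        have h3 := (hS c' hq.1).2 i
        rw [Pi.sub_apply, abs_le]
        constructor <;> linarith)
      have htj := h𝒯 _ (ht j)
      have h2 : |t j * ((k : ℝ) / (2 * T) - k' / (2 * T))| ≤ 1 / 16 := by
        have h3 := hk k hp.2 _ htj
        have h4 := hk k' hq.2 _ htj
        rw [abs_mul]
        have h5 : (0 : ℝ) ≤ k / (2 * T) := by positivity
        have h6 : (0 : ℝ) ≤ k' / (2 * T) := by positivity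
        have h7 : |(k : ℝ) / (2 * T) - k' / (2 * T)| ≤ max (k / (2 * T)) (k' / (2 * T)) := by
          rw [abs_le]
          have := le_max_left ((k : ℝ) / (2 * T)) (k' / (2 * T))
          have := le_max_right ((k : ℝ) / (2 * T)) (k' / (2 * T))
          constructor <;> linarith
        rcases max_choice ((k : ℝ) / (2 * T)) (k' / (2 * T)) with h8 | h8 <;> rw [h8] at h7
        · exact (mul_le_mul_of_nonneg_left h7 (abs_nonneg _)).trans h3
        · exact (mul_le_mul_of_nonneg_left h7 (abs_nonneg _)).trans h4
      have h3 : t j * (f (c, k) - f (c', k')) = roundPair x (c - c') (t j) +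
          (t j * ∑ i, (c - c') i * x i - roundPair x (c - c') (t j)) +
          t j * ((k : ℝ) / (2 * T) - k' / (2 * T)) := by
        simp only [hf, Pi.sub_apply, sub_mul, Finset.sum_sub_distrib]
        ring
      have h4 : 1 / 2 ≤ |t j * (f (c, k) - f (c', k'))| := by
        rw [h3]
        have h5 := abs_sub_abs_le_abs_sub (roundPair x (c - c') (t j))
          (-((t j * ∑ i, (c - c') i * x i - roundPair x (c - c') (t j)) +
          t j * ((k : ℝ) / (2 * T) - k' / (2 * T))))
        rw [abs_neg, sub_neg_eq_add, ← add_assoc] at h5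
        have h6 := abs_add_le (t j * ∑ i, (c - c') i * x i - roundPair x (c - c') (t j))
          (t j * ((k : ℝ) / (2 * T) - k' / (2 * T)))
        linarith
      rw [abs_mul] at h4
      have h5 : |t j| * |f (c, k) - f (c', k')| ≤ T * |f (c, k) - f (c', k')| := by
        gcongr
        exact htj.trans ht₀T
      rw [div_le_iff₀ (by positivity)]
      linarith
  have hinj : Set.InjOn f (S ×ˢ Finset.range n : Finset _) := by
    intro p hp q hq hpq
    by_contra hne
    have := hsep p hp q hq hne
    rw [hpq, sub_self, abs_zero] at this
    have h0 : 0 < 1 / (2 * T) := by positivity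
    linarith
  have hcard : #((S ×ˢ Finset.range n).image f) = J ^ d * (cell Λ).ncard * n := by
    rw [Finset.card_image_of_injOn hinj, Finset.card_product, hScard, Finset.card_range]
  rw [← hcard]
  refine hsieve _ ?_ ?_
  · intro z hz w hw hne
    obtain ⟨p, hp, rfl⟩ := Finset.mem_image.mp hz
    obtain ⟨q, hq, rfl⟩ := Finset.mem_image.mp hw
    exact hsep p hp q hq fun h => hne (by rw [h])
  · intro z hz
    obtain ⟨⟨c, k⟩, hp, rfl⟩ := Finset.mem_image.mp hz
    rw [Finset.mem_product, Finset.mem_range] at hp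
    refine half_le_integral_cos hbad fun s hs => ?_
    simp only [badSet, Set.mem_ofPred_eq, not_not] at hs
    obtain ⟨hs1, hs2, hs3⟩ := hs
    obtain ⟨q, hq⟩ := hs3 c (hS c hp.1).1
    refine ⟨q, ?_⟩
    have h1 := abs_mul_sum_sub_roundPair_le (R := J) (c := c) hs2 (fun i => by
      have h2 := (hS c hp.1).2 i
      rw [abs_of_nonneg h2.1]; exact h2.2)
    have h2 : |s * ((k : ℝ) / (2 * T))| ≤ 1 / 16 := by
      rw [abs_mul, abs_of_nonneg (by positivity : (0 : ℝ) ≤ k / (2 * T))]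
      exact hk k hp.2 s (h𝒯 s hs1)
    rw [hq] at h1
    have h3 : s * f (c, k) - q = (s * ∑ i, c i * x i - q) + s * ((k : ℝ) / (2 * T)) := by
      simp only [hf]; ring
    rw [h3]
    have := abs_add_le (s * ∑ i, c i * x i - q) (s * ((k : ℝ) / (2 * T)))
    linarith

lemma exists_cramer_coeff {d : ℕ} {t x : Fin d → ℝ} (hdet : (roundMat t x).det ≠ 0) (y : ℝ) :
    ∃ c : Fin d → ℝ, (∀ j, roundPair x c (t j) = round (t j * y)) ∧
      ∀ i, ((roundMat t x).det : ℝ) * c i = ((roundMat t (Function.update x i y)).det : ℤ) := by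
  set B := roundMat t x with hB
  set a : Fin d → ℤ := fun j => round (t j * y)
  have hdet' : (B.det : ℝ) ≠ 0 := by exact_mod_cast hdet
  have hup : ∀ i, B.updateCol i a = roundMat t (Function.update x i y) := by
    intro i
    ext j k
    simp only [hB, roundMat, Matrix.updateCol_apply, Matrix.of_apply, Function.update_apply, a]
    split_ifs <;> rfl
  refine ⟨fun i => (B.cramer a i : ℝ) / B.det, fun j => ?_, fun i => ?_⟩
  · have h := congrFun (B.mulVec_cramer a) j
    simp only [Matrix.mulVec, dotProduct, Pi.smul_apply, smul_eq_mul] at h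
    have h' : ∑ k, (B j k : ℝ) * (B.cramer a k : ℝ) = B.det * a j := by exact_mod_cast h
    have h2 : roundPair x (fun i => (B.cramer a i : ℝ) / B.det) (t j) =
        (∑ k, (B j k : ℝ) * (B.cramer a k : ℝ)) / B.det := by
      rw [roundPair, Finset.sum_div]
      refine Finset.sum_congr rfl fun k _ => ?_
      simp only [hB, roundMat, Matrix.of_apply]
      ring
    rw [h2, h']
    field_simp
    rfl
  · rw [← hup, ← Matrix.cramer_apply]
    field_simp

lemma round_eq_roundPair {d : ℕ} {t x c : Fin d → ℝ} {y s : ℝ} (hdet : (roundMat t x).det ≠ 0)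
    (hc : ∀ j, roundPair x c (t j) = round (t j * y))
    (h0 : (roundMat (Fin.snoc t s : Fin (d + 1) → ℝ) (Fin.snoc x y)).det = 0) :
    (round (s * y) : ℝ) = roundPair x c s := by
  obtain ⟨w, hw0, hw⟩ := Matrix.exists_mulVec_eq_zero_iff.mpr h0
  have hrow : ∀ u : ℝ, ∀ j : Fin (d + 1), (Fin.snoc t s : Fin (d + 1) → ℝ) j = u →
      roundPair x (fun i => (w (Fin.castSucc i) : ℝ)) u + w (Fin.last d) * (round (u * y) : ℝ) = 0 := by
    intro u j hj
    have h1 := congrFun hw j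
    simp only [Matrix.mulVec, dotProduct, roundMat, Matrix.of_apply, hj, Fin.sum_univ_castSucc,
      Fin.snoc_castSucc, Fin.snoc_last, Pi.zero_apply] at h1
    have h2 : ∑ i, (round (u * x i) : ℝ) * (w (Fin.castSucc i) : ℝ) +
        (round (u * y) : ℝ) * w (Fin.last d) = 0 := by exact_mod_cast h1
    rw [roundPair, ← h2]
    congr 1
    · exact Finset.sum_congr rfl fun i _ => mul_comm _ _
    · ring
  have hrowj : ∀ j, roundPair x (fun i => (w (Fin.castSucc i) : ℝ)) (t j) +
      w (Fin.last d) * (round (t j * y) : ℝ) = 0 := fun j =>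
    hrow (t j) (Fin.castSucc j) (by simp)
  have hlast := hrow s (Fin.last d) (by simp)
  have hwl : ∀ v : Fin d → ℝ, (∀ j, roundPair x v (t j) = 0) → v = 0 := by
    intro v hv
    by_contra hne
    obtain ⟨j, hj⟩ := exists_roundPair_ne_zero hdet hne
    exact hj (hv j)
  have hlin : ∀ u, roundPair x (fun i => (w (Fin.castSucc i) : ℝ) + w (Fin.last d) * c i) u =
      roundPair x (fun i => (w (Fin.castSucc i) : ℝ)) u + w (Fin.last d) * roundPair x c u := by
    intro u
    simp only [roundPair, add_mul, Finset.sum_add_distrib, Finset.mul_sum, mul_assoc]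
  have hv := hwl (fun i => (w (Fin.castSucc i) : ℝ) + w (Fin.last d) * c i) fun j => by
    rw [hlin, hc]; exact hrowj j
  have hwne : (w (Fin.last d) : ℝ) ≠ 0 := by
    intro hz
    apply hw0
    funext i
    refine Fin.lastCases (by exact_mod_cast hz) (fun i => ?_) i
    have := congrFun hv i
    simp only [hz, zero_mul, add_zero, Pi.zero_apply] at this
    exact_mod_cast this
  have h3 := hlin s
  rw [hv] at h3
  have h4 : roundPair x (0 : Fin d → ℝ) s = 0 := by simp [roundPair]
  rw [h4] at h3
  have h5 : (w (Fin.last d) : ℝ) * ((round (s * y) : ℝ) - roundPair x c s) = 0 := by linarith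
  have := (mul_eq_zero.mp h5).resolve_left hwne
  linarith

lemma measureReal_nerr_le {M : Measure ℝ} [IsFiniteMeasure M] {f : ℝ → ℝ} (hf : Measurable f)
    {K ρ : ℝ} (hρ : 0 < ρ) (hK : ∫ x, nerr (f x) ^ 2 ∂M ≤ K) :
    M.real {x | ρ ≤ |nerr (f x)|} ≤ K / ρ ^ 2 := by
  rw [le_div_iff₀ (by positivity), mul_comm]
  refine le_trans ?_ hK
  refine le_trans ?_ (mul_meas_ge_le_integral_of_nonneg
    (Filter.Eventually.of_forall fun x => sq_nonneg _) (nerr_sq_integrable hf) (ρ ^ 2))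
  refine mul_le_mul_of_nonneg_left (measureReal_mono fun x hx => ?_) (sq_nonneg ρ)
  simp only [Set.mem_ofPred_eq] at hx ⊢
  rw [← sq_abs (nerr (f x))]
  exact pow_le_pow_left₀ hρ.le hx 2

lemma measureReal_nerr_lt_le {M : Measure ℝ} [IsFiniteMeasure M] {f : ℝ → ℝ} (hf : Measurable f)
    {K ρ : ℝ} (hρ : 0 < ρ) (hK : ∫ x, nerr (f x) ^ 2 ∂M ≤ K) :
    M.real {x | ρ < |nerr (f x)|} ≤ K / ρ ^ 2 :=
  have hsub : {x | ρ < |nerr (f x)|} ⊆ {x | ρ ≤ |nerr (f x)|} := fun x hx => by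
    simp only [Set.mem_ofPred_eq] at hx ⊢
    exact hx.le
  (measureReal_mono hsub).trans (measureReal_nerr_le hf hρ hK)

lemma measureReal_compl_forall_le {M : Measure ℝ} [IsFiniteMeasure M] {d : ℕ} {A : Set ℝ}
    {P : Fin d → ℝ → Prop} {a b : ℝ} (hA : M.real Aᶜ ≤ a) (hP : ∀ i, M.real {x | ¬ P i x} ≤ b) :
    M.real {x | ¬ (x ∈ A ∧ ∀ i, P i x)} ≤ a + d * b := by
  have hsub : {x | ¬ (x ∈ A ∧ ∀ i, P i x)} ⊆ Aᶜ ∪ ⋃ i, {x | ¬ P i x} := by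
    intro x hx
    simp only [Set.mem_ofPred_eq, not_and, not_forall] at hx
    by_cases hxA : x ∈ A
    · obtain ⟨i, hi⟩ := hx hxA
      exact Or.inr (Set.mem_iUnion.mpr ⟨i, hi⟩)
    · exact Or.inl hxA
  refine (measureReal_mono hsub).trans ((measureReal_union_le _ _).trans (add_le_add hA ?_))
  refine (measureReal_iUnion_fintype_le _).trans ?_
  refine (Finset.sum_le_card_nsmul _ _ b fun i _ => hP i).trans ?_
  simp

/-- The lattice of integer vectors. -/
def intLattice (d : ℕ) : Submodule ℤ (Fin d → ℝ) where
  carrier := Set.range intVec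
  add_mem' := by
    rintro _ _ ⟨k, rfl⟩ ⟨k', rfl⟩
    exact ⟨k + k', by funext i; simp [intVec]⟩
  zero_mem' := ⟨0, by funext i; simp [intVec]⟩
  smul_mem' := by
    rintro q _ ⟨k, rfl⟩
    exact ⟨q • k, by funext i; simp [intVec]⟩

lemma intLattice_isOverlattice (d : ℕ) (N : ℤ) : IsOverlattice N (intLattice d) := by
  refine ⟨fun k => ⟨k, rfl⟩, ?_⟩
  rintro _ ⟨k, rfl⟩ i
  exact ⟨N * k i, by simp [intVec]⟩

lemma roundPair_intLattice {d : ℕ} (x : Fin d → ℝ) {c : Fin d → ℝ} (hc : c ∈ intLattice d)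
    (t : ℝ) : ∃ z : ℤ, roundPair x c t = z := by
  obtain ⟨k, rfl⟩ := hc
  exact ⟨∑ i, k i * round (t * x i), by simp [roundPair, intVec]⟩

lemma badSet_intLattice {d : ℕ} (𝒯 : Set ℝ) (θ : ℝ) (x : Fin d → ℝ) :
    badSet 𝒯 θ x (intLattice d) = {t | ¬ (t ∈ 𝒯 ∧ ∀ i, |nerr (t * x i)| ≤ θ)} := by
  ext t
  simp only [badSet, Set.mem_ofPred_eq]
  have : ∀ c ∈ intLattice d, ∃ z : ℤ, roundPair x c t = z := fun c hc => roundPair_intLattice x hc t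
  tauto

lemma roundPair_sup_span {d : ℕ} {x c : Fin d → ℝ} {Λ : Submodule ℤ (Fin d → ℝ)} {t : ℝ}
    (hΛ : ∀ v ∈ Λ, ∃ z : ℤ, roundPair x v t = z) (hc : ∃ z : ℤ, roundPair x c t = z) :
    ∀ v ∈ Λ ⊔ Submodule.span ℤ {c}, ∃ z : ℤ, roundPair x v t = z := by
  intro v hv
  obtain ⟨y, hy, z, hz, rfl⟩ := Submodule.mem_sup.mp hv
  obtain ⟨q, rfl⟩ := Submodule.mem_span_singleton.mp hz
  obtain ⟨a, ha⟩ := hΛ y hy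
  obtain ⟨b, hb⟩ := hc
  refine ⟨a + q * b, ?_⟩
  push_cast
  rw [← ha, ← hb]
  simp only [roundPair, Pi.add_apply, zsmul_eq_mul, Pi.mul_apply, add_mul,
    Finset.sum_add_distrib, Finset.mul_sum, mul_assoc]
  simp

lemma min_one_sq_div_le {l l₁ : ℝ} (hl : 2 ≤ l) (hl₁ : 1 < l₁) :
    min 1 ((l / l₁) ^ 2) ≤ Real.log l / Real.log l₁ := by
  have hlog : 0 < Real.log l₁ := Real.log_pos hl₁
  rw [le_div_iff₀ hlog]
  rcases le_total l₁ l with h | h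
  · have h1 : Real.log l₁ ≤ Real.log l := Real.log_le_log (by linarith) h
    have h2 := min_le_left 1 ((l / l₁) ^ 2)
    nlinarith
  · have hexp : Real.exp 2⁻¹ ≤ 2 := by
      have h1 : Real.exp 2⁻¹ * Real.exp 2⁻¹ = Real.exp 1 := by
        rw [← Real.exp_add]; norm_num
      have h2 := Real.exp_one_lt_d9
      nlinarith [Real.exp_pos 2⁻¹]
    have h1 := Real.log_div_self_rpow_antitoneOn (a := 2) (by norm_num)
      (Set.mem_Ici.mpr (hexp.trans hl)) (Set.mem_Ici.mpr (hexp.trans (hl.trans h))) h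
    simp only at h1
    have h2 : (2 : ℝ) = ((2 : ℕ) : ℝ) := by norm_num
    rw [h2, Real.rpow_natCast, Real.rpow_natCast, div_le_div_iff₀ (by positivity) (by positivity)] at h1
    have h3 := min_le_right 1 ((l / l₁) ^ 2)
    calc min 1 ((l / l₁) ^ 2) * Real.log l₁ ≤ (l / l₁) ^ 2 * Real.log l₁ := by gcongr
      _ = (Real.log l₁ * l ^ 2) / l₁ ^ 2 := by ring
      _ ≤ (Real.log l * l₁ ^ 2) / l₁ ^ 2 := by gcongr
      _ = Real.log l := by field_simp

lemma measureReal_le_of_subset_Icc {ν : Measure ℝ} [IsProbabilityMeasure ν] {T q : ℝ} (hq : 0 < q)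
    (hν : ν ≤ ENNReal.ofReal q • (volume.restrict (Set.Icc (-T) T))) {X : Set ℝ} {u v : ℝ}
    (huv : u ≤ v) (hX : X ⊆ Set.Icc u v) : ν.real X ≤ q * (v - u) := by
  have h1 : ν X ≤ ENNReal.ofReal (q * (v - u)) := by
    calc ν X ≤ (ENNReal.ofReal q • (volume.restrict (Set.Icc (-T) T))) X := hν X
      _ ≤ ENNReal.ofReal q * volume (Set.Icc u v) := by
          rw [Measure.smul_apply, smul_eq_mul]
          exact mul_le_mul_right ((Measure.restrict_apply_le _ _).trans (measure_mono hX)) _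
      _ = _ := by rw [Real.volume_Icc, ENNReal.ofReal_mul hq.le]
  exact ENNReal.toReal_le_of_le_ofReal (mul_nonneg hq.le (by linarith)) h1

/-- A set of frequencies of nearly full measure has an element dominating most of it. -/
lemma exists_top_frequency {ν : Measure ℝ} [IsProbabilityMeasure ν] {T q : ℝ} (hq : 0 < q)
    (hν : ν ≤ ENNReal.ofReal q • (volume.restrict (Set.Icc (-T) T))) {S : Set ℝ}
    (hS : ν.real Sᶜ ≤ 1 / 100) :
    ∃ s₀ ∈ S, s₀ ≠ 0 ∧ |s₀| ≤ T ∧ ν.real {t | t ∈ S ∧ |t| ≤ |s₀|}ᶜ ≤ 1 / 50 := by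
  set S' := S ∩ Set.Icc (-T) T with hS'
  have h0 : ν.real (Set.Icc (-T) T)ᶜ = 0 := by
    rw [measureReal_eq_zero_iff]
    refine le_antisymm ((hν _).trans ?_) zero_le
    rw [Measure.smul_apply, Measure.restrict_apply measurableSet_Icc.compl]
    simp
  have h1 : ν.real S'ᶜ ≤ 1 / 100 := by
    rw [hS', Set.compl_inter]
    have := measureReal_union_le (μ := ν) Sᶜ (Set.Icc (-T) T)ᶜ
    linarith
  have htot : ∀ X : Set ℝ, 1 ≤ ν.real X + ν.real Xᶜ := by
    intro X
    have := measureReal_union_le (μ := ν) X Xᶜ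
    rw [Set.union_compl_self] at this
    simpa using this
  have hne : S'.Nonempty := by
    by_contra h
    have := htot S'
    rw [Set.not_nonempty_iff_eq_empty.mp h] at this h1
    simp only [measureReal_empty] at this
    linarith
  have habs : ∀ t ∈ S', |t| ≤ T := fun t ht => abs_le.mpr ht.2
  set R := (fun t : ℝ => |t|) '' S' with hR
  have hbdd : BddAbove R := ⟨T, by rintro _ ⟨t, ht, rfl⟩; exact habs t ht⟩
  set δ := 1 / (200 * q) with hδ
  have hδ0 : 0 < δ := by positivity
  have hqδ : q * (2 * δ) = 1 / 100 := by rw [hδ]; field_simp; norm_num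
  obtain ⟨_, ⟨s₀, hs₀, rfl⟩, hlt⟩ := exists_lt_of_lt_csSup (hne.image _)
    (show sSup R - δ < sSup R by linarith)
  simp only at hlt
  have hle : ∀ t ∈ S', |t| ≤ sSup R := fun t ht => le_csSup hbdd ⟨t, ht, rfl⟩
  refine ⟨s₀, hs₀.1, ?_, habs _ hs₀, ?_⟩
  · rintro rfl
    rw [abs_zero] at hlt
    have h2 : ν.real S' ≤ q * (δ - -δ) :=
      measureReal_le_of_subset_Icc hq hν (by linarith) fun t ht =>
        abs_le.mp ((hle t ht).trans (by linarith))
    have := htot S'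
    have h3 : q * (δ - -δ) = q * (2 * δ) := by ring
    linarith
  · set b := sSup R
    have hsub : {t | t ∈ S ∧ |t| ≤ |s₀|}ᶜ ⊆
        S'ᶜ ∪ (Set.Icc (-b) (-(b - δ)) ∪ Set.Icc (b - δ) b) := by
      intro t ht
      by_cases htS : t ∈ S'
      · right
        simp only [Set.mem_compl_iff, Set.mem_ofPred_eq, not_and, not_le] at ht
        have h2 := ht htS.1
        have h3 := hle t htS
        rcases abs_cases t with h4 | h4
        · right; constructor <;> linarith
        · left; constructor <;> linarith
      · exact Or.inl htS
    have h2 := measureReal_mono (μ := ν) hsub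
    have h3 := measureReal_union_le (μ := ν) S'ᶜ (Set.Icc (-b) (-(b - δ)) ∪ Set.Icc (b - δ) b)
    have h4 := measureReal_union_le (μ := ν) (Set.Icc (-b) (-(b - δ))) (Set.Icc (b - δ) b)
    have h5 := measureReal_le_of_subset_Icc hq hν (show -b ≤ -(b - δ) by linarith) subset_rfl
    have h6 := measureReal_le_of_subset_Icc hq hν (show b - δ ≤ b by linarith) subset_rfl
    have h7 : q * (-(b - δ) - -b) + q * (b - (b - δ)) = q * (2 * δ) := by ring
    linarith

/-- The frequencies in `𝒯` and the points in `A` have products close to integers,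
except for a small proportion of pairs. -/
structure IsNearIntegral (ν W : Measure ℝ) (n : ℕ) (T M θ β X s₀ : ℝ) (𝒯 A : Set ℝ) : Prop where
  n_pos : 0 < n
  T_pos : 0 < T
  θ_pos : 0 < θ
  θ_le : 16 * n * θ ≤ 1
  sieve : ∀ Z : Finset ℝ, (∀ z ∈ Z, ∀ w ∈ Z, z ≠ w → 1 / (2 * T) ≤ |z - w|) →
    (∀ z ∈ Z, 1 / 2 ≤ ∫ t, Real.cos (2 * Real.pi * (t * z)) ∂ν) → (#Z : ℝ) ≤ M
  top_mem : s₀ ∈ 𝒯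
  top_ne : s₀ ≠ 0
  top_le : |s₀| ≤ T
  le_top : ∀ t ∈ 𝒯, |t| ≤ |s₀|
  freq : ν.real 𝒯ᶜ ≤ 1 / 50
  pts : W.real Aᶜ ≤ β / 4
  freq_nerr : ∀ t ∈ 𝒯, W.real {x | θ < |nerr (t * x)|} ≤ β / (64 * n)
  pts_le : ∀ x ∈ A, |x| ≤ X
  pts_nerr : ∀ x ∈ A, ∫ t, nerr (t * x) ^ 2 ∂ν ≤ θ ^ 2 / (400 * n)
  pts_top : ∀ x ∈ A, |nerr (s₀ * x)| ≤ θ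
  lt_pow : M < (⌊1 / (16 * n * θ)⌋₊ : ℝ) ^ n

/-- Linearly independent points, seen through finitely many frequencies. -/
structure IsFrame {d : ℕ} (𝒯 A : Set ℝ) (θ : ℝ) (t x : Fin d → ℝ) : Prop where
  freq_mem : ∀ j, t j ∈ 𝒯
  pt_mem : ∀ i, x i ∈ A
  err : ∀ j i, |nerr (t j * x i)| ≤ θ
  det_ne : (roundMat t x).det ≠ 0

namespace IsNearIntegral

variable {ν W : Measure ℝ} {n : ℕ}
  {T M θ β X s₀ : ℝ} {𝒯 A : Set ℝ}

lemma nerr_le [IsProbabilityMeasure ν] (h : IsNearIntegral ν W n T M θ β X s₀ 𝒯 A) {x ρ : ℝ} (hx : x ∈ A) (hρ : 0 < ρ) :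
    ν.real {t | ρ ≤ |nerr (t * x)|} ≤ (θ / ρ) ^ 2 / (400 * n) := by
  refine (measureReal_nerr_le (by fun_prop) hρ (h.pts_nerr x hx)).trans (le_of_eq ?_)
  rw [div_pow, div_div, div_div, mul_comm]

lemma nerr_lt_le [IsProbabilityMeasure ν] (h : IsNearIntegral ν W n T M θ β X s₀ 𝒯 A) {x : ℝ} (hx : x ∈ A) :
    ν.real {t | ¬ |nerr (t * x)| ≤ θ} ≤ 1 / (400 * n) := by
  simp only [not_le]
  have hθ := h.θ_pos
  refine (measureReal_nerr_lt_le (by fun_prop) hθ (h.pts_nerr x hx)).trans (le_of_eq ?_)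
  field_simp

lemma badSet_intLattice_le [IsProbabilityMeasure ν] (h : IsNearIntegral ν W n T M θ β X s₀ 𝒯 A) {d : ℕ} (hd : d ≤ n)
    {x : Fin d → ℝ} (hx : ∀ i, x i ∈ A) : ν.real (badSet 𝒯 θ x (intLattice d)) ≤ 1 / 25 := by
  rw [badSet_intLattice]
  refine (measureReal_compl_forall_le h.freq fun i => h.nerr_lt_le (hx i)).trans ?_
  have hn : (0 : ℝ) < n := by exact_mod_cast h.n_pos
  have hdn : (d : ℝ) ≤ n := by exact_mod_cast hd
  have : (d : ℝ) * (1 / (400 * n)) ≤ 1 / 400 := by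
    rw [mul_one_div, div_le_div_iff₀ (by positivity) (by positivity)]
    linarith
  linarith

lemma mul_floor_le (h : IsNearIntegral ν W n T M θ β X s₀ 𝒯 A) {d : ℕ} (hd : d ≤ n) :
    (d : ℝ) * ⌊1 / (16 * n * θ)⌋₊ * θ ≤ 1 / 16 := by
  have hθ := h.θ_pos
  have hn : (0 : ℝ) < n := by exact_mod_cast h.n_pos
  have h1 : (⌊1 / (16 * n * θ)⌋₊ : ℝ) ≤ 1 / (16 * n * θ) := Nat.floor_le (by positivity)
  have hdn : (d : ℝ) ≤ n := by exact_mod_cast hd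
  calc (d : ℝ) * ⌊1 / (16 * n * θ)⌋₊ * θ ≤ n * (1 / (16 * n * θ)) * θ := by gcongr
    _ = 1 / 16 := by field_simp

lemma card_le [IsProbabilityMeasure ν] (h : IsNearIntegral ν W n T M θ β X s₀ 𝒯 A) {d : ℕ} (hd : d ≤ n) {t x : Fin d → ℝ}
    (hf : IsFrame 𝒯 A θ t x) {N : ℤ} (hN : N ≠ 0) {Λ : Submodule ℤ (Fin d → ℝ)}
    (hΛ : IsOverlattice N Λ) (hInt : ∀ c ∈ Λ, ∀ j, ∃ z : ℤ, roundPair x c (t j) = z)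
    (hbad : ν.real (badSet 𝒯 θ x Λ) ≤ 1 / 10) {k : ℕ}
    (hk : ∀ i < k, i / (2 * T) ≤ 1 / (16 * |s₀|)) :
    ((⌊1 / (16 * n * θ)⌋₊ ^ d * (cell Λ).ncard * k : ℕ) : ℝ) ≤ M :=
  card_le_of_visible h.T_pos h.sieve hΛ hN (abs_pos.mpr h.top_ne) h.top_le h.le_top hf.freq_mem
    hf.err hf.det_ne hInt hbad (h.mul_floor_le hd) hk

lemma not_isFrame [IsProbabilityMeasure ν] (h : IsNearIntegral ν W n T M θ β X s₀ 𝒯 A) (t x : Fin n → ℝ) :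
    ¬ IsFrame 𝒯 A θ t x := by
  intro hf
  have h1 := h.card_le le_rfl hf one_ne_zero (intLattice_isOverlattice n 1)
    (fun c hc j => roundPair_intLattice x hc _)
    ((h.badSet_intLattice_le le_rfl hf.pt_mem).trans (by norm_num)) (k := 1) (by
      intro i hi
      obtain rfl : i = 0 := by omega
      have := abs_pos.mpr h.top_ne
      simp)
  have h2 := (intLattice_isOverlattice n 1).ncard_cell_pos one_ne_zero
  have h3 := h.lt_pow
  have h4 : (1 : ℝ) ≤ (cell (intLattice n)).ncard := by exact_mod_cast h2
  push_cast at h1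
  have h5 : (0 : ℝ) ≤ (⌊1 / (16 * n * θ)⌋₊ : ℝ) ^ n := by positivity
  nlinarith

lemma bddAbove_natAbs_det (h : IsNearIntegral ν W n T M θ β X s₀ 𝒯 A) (d : ℕ) :
    BddAbove {k : ℕ | ∃ t x : Fin d → ℝ, IsFrame 𝒯 A θ t x ∧ k = (roundMat t x).det.natAbs} := by
  refine ⟨(d.factorial • ⌈|s₀| * X + 1⌉ ^ d).toNat, ?_⟩
  rintro _ ⟨t, x, hf, rfl⟩
  have h1 := Matrix.det_le (A := roundMat t x) (abv := AbsoluteValue.abs)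
    (x := ⌈|s₀| * X + 1⌉) (by
      intro j i
      simp only [AbsoluteValue.abs_apply, roundMat, Matrix.of_apply]
      have h2 : |((round (t j * x i) : ℤ) : ℝ)| ≤ |s₀| * X + 1 := by
        have h3 := abs_nerr_le (t j * x i)
        have h4 : |t j * x i| ≤ |s₀| * X := by
          rw [abs_mul]
          exact mul_le_mul (h.le_top _ (hf.freq_mem j)) (h.pts_le _ (hf.pt_mem i)) (abs_nonneg _)
            (abs_nonneg _)
        rw [nerr] at h3
        rw [abs_le] at *
        constructor <;> linarith
      have h3 : (|round (t j * x i)| : ℝ) ≤ (⌈|s₀| * X + 1⌉ : ℤ) := h2.trans (Int.le_ceil _)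
      exact_mod_cast h3)
  rw [AbsoluteValue.abs_apply, Fintype.card_fin, Int.abs_eq_natAbs] at h1
  omega

/-- A frame that cannot be extended, with maximal determinant. -/
lemma exists_max_frame [IsProbabilityMeasure ν] (h : IsNearIntegral ν W n T M θ β X s₀ 𝒯 A) :
    ∃ d < n, ∃ t x : Fin d → ℝ, IsFrame 𝒯 A θ t x ∧
      (∀ t' x' : Fin d → ℝ, IsFrame 𝒯 A θ t' x' →
        |(roundMat t' x').det| ≤ |(roundMat t x).det|) ∧
      ∀ t' x' : Fin (d + 1) → ℝ, ¬ IsFrame 𝒯 A θ t' x' := by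
  classical
  have hex : ∃ k, ¬ ∃ t x : Fin k → ℝ, IsFrame 𝒯 A θ t x :=
    ⟨n, by push Not; exact h.not_isFrame⟩
  have hle : Nat.find hex ≤ n := Nat.find_min' hex (by push Not; exact h.not_isFrame)
  have h0 : Nat.find hex ≠ 0 := by
    intro h0
    have := Nat.find_spec hex
    rw [h0] at this
    exact this ⟨Fin.elim0, Fin.elim0, fun j => Fin.elim0 j, fun j => Fin.elim0 j,
      fun j => Fin.elim0 j, by simp⟩
  obtain ⟨d, hd⟩ := Nat.exists_eq_succ_of_ne_zero h0
  have hspec := Nat.find_spec hex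
  have hmin := Nat.find_min hex (m := d) (by omega)
  rw [hd] at hspec
  rw [not_not] at hmin
  obtain ⟨t, x, hf⟩ := hmin
  have hne : {k : ℕ | ∃ t x : Fin d → ℝ, IsFrame 𝒯 A θ t x ∧
      k = (roundMat t x).det.natAbs}.Nonempty := ⟨_, t, x, hf, rfl⟩
  obtain ⟨t, x, hf', heq⟩ := Nat.sSup_mem hne (h.bddAbove_natAbs_det d)
  refine ⟨d, by omega, t, x, hf', fun t' x' hf'' => ?_, ?_⟩
  · have := le_csSup (h.bddAbove_natAbs_det d) ⟨t', x', hf'', rfl⟩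
    rw [heq] at this
    rw [Int.abs_eq_natAbs, Int.abs_eq_natAbs]
    exact_mod_cast this
  · push Not at hspec
    exact hspec

end IsNearIntegral

namespace IsNearIntegral

variable {ν W : Measure ℝ} {n : ℕ} {T M θ β X s₀ : ℝ} {𝒯 A : Set ℝ}

lemma exists_coeff (h : IsNearIntegral ν W n T M θ β X s₀ 𝒯 A) {d : ℕ} (hd : d < n)
    {t x : Fin d → ℝ} (hf : IsFrame 𝒯 A θ t x)
    (hmax : ∀ t' x' : Fin d → ℝ, IsFrame 𝒯 A θ t' x' →
      |(roundMat t' x').det| ≤ |(roundMat t x).det|)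
    (hext : ∀ t' x' : Fin (d + 1) → ℝ, ¬ IsFrame 𝒯 A θ t' x') {y : ℝ} (hyA : y ∈ A)
    (hy : ∀ j, |nerr (t j * y)| ≤ θ) :
    ∃ c : Fin d → ℝ, (∀ i, |c i| ≤ 1) ∧ (∀ i, ∃ k : ℤ, ((roundMat t x).det : ℝ) * c i = k) ∧
      (∀ j, roundPair x c (t j) = round (t j * y)) ∧
      (∀ s ∈ 𝒯, (∀ i, |nerr (s * x i)| ≤ θ) → |nerr (s * y)| ≤ θ →
        (round (s * y) : ℝ) = roundPair x c s) ∧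
      |y - ∑ i, c i * x i| ≤ n * θ / |s₀| := by
  classical
  obtain ⟨c, hc, hdet⟩ := exists_cramer_coeff hf.det_ne y
  have hround : ∀ s ∈ 𝒯, (∀ i, |nerr (s * x i)| ≤ θ) → |nerr (s * y)| ≤ θ →
      (round (s * y) : ℝ) = roundPair x c s := by
    intro s hs hsx hsy
    refine round_eq_roundPair hf.det_ne hc ?_
    by_contra h0
    refine hext (Fin.snoc t s) (Fin.snoc x y) ⟨?_, ?_, ?_, h0⟩
    · intro j
      refine Fin.lastCases ?_ (fun j => ?_) j
      · simpa using hs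
      · simpa using hf.freq_mem j
    · intro j
      refine Fin.lastCases ?_ (fun j => ?_) j
      · simpa using hyA
      · simpa using hf.pt_mem j
    · intro j i
      refine Fin.lastCases ?_ (fun j => ?_) j <;> refine Fin.lastCases ?_ (fun i => ?_) i
      · simpa using hsy
      · simpa using hsx i
      · simpa using hy j
      · simpa using hf.err j i
  have hc1 : ∀ i, |c i| ≤ 1 := by
    intro i
    have hle : |(roundMat t (Function.update x i y)).det| ≤ |(roundMat t x).det| := by
      by_cases h0 : (roundMat t (Function.update x i y)).det = 0
      · rw [h0, abs_zero]; exact abs_nonneg _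
      · refine hmax _ _ ⟨hf.freq_mem, fun k => ?_, fun j k => ?_, h0⟩
        · by_cases hk : k = i
          · subst hk; simpa using hyA
          · simpa [Function.update_of_ne hk] using hf.pt_mem k
        · by_cases hk : k = i
          · subst hk; simpa using hy j
          · simpa [Function.update_of_ne hk] using hf.err j k
    have h1 := congrArg abs (hdet i)
    rw [abs_mul] at h1
    have h2 : |((roundMat t (Function.update x i y)).det : ℝ)| ≤ |((roundMat t x).det : ℝ)| := by
      exact_mod_cast hle
    have h3 : 0 < |((roundMat t x).det : ℝ)| := abs_pos.mpr (by exact_mod_cast hf.det_ne)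
    rw [← h1] at h2
    exact le_of_mul_le_mul_left (by linarith) h3
  refine ⟨c, hc1, fun i => ⟨_, hdet i⟩, hc, hround, ?_⟩
  have hs := abs_pos.mpr h.top_ne
  have htop := fun i => h.pts_top _ (hf.pt_mem i)
  have h1 := hround s₀ h.top_mem htop (h.pts_top y hyA)
  have h2 := abs_mul_sum_sub_roundPair_le htop hc1
  have h3 := h.pts_top y hyA
  have hθ := h.θ_pos
  have hdn : (d : ℝ) + 1 ≤ n := by exact_mod_cast hd
  rw [le_div_iff₀ hs, mul_comm, ← abs_mul]
  have h4 : s₀ * (y - ∑ i, c i * x i) = nerr (s₀ * y) - (s₀ * ∑ i, c i * x i - roundPair x c s₀) := by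
    rw [nerr, h1]; ring
  rw [h4]
  have h5 := abs_sub (nerr (s₀ * y)) (s₀ * ∑ i, c i * x i - roundPair x c s₀)
  nlinarith

lemma le_abs_nerr (h : IsNearIntegral ν W n T M θ β X s₀ 𝒯 A) {d : ℕ} (hd : d < n)
    {x c : Fin d → ℝ} {y s : ℝ} {l : ℕ} (hl : 0 < l) (hc1 : ∀ i, |c i| ≤ 1)
    (hyc : |y - ∑ i, c i * x i| ≤ n * θ / |s₀|) (hs : s ∈ 𝒯) (hsx : ∀ i, |nerr (s * x i)| ≤ θ)
    (hlP : ∃ z : ℤ, l * roundPair x c s = z) (hP : ¬ ∃ z : ℤ, roundPair x c s = z)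
    (hsy : θ ≤ |nerr (s * y)|) : 1 / (2 * n * l) ≤ |nerr (s * y)| := by
  obtain ⟨z, hz⟩ := hlP
  have hl0 : (0 : ℝ) < l := by exact_mod_cast hl
  have hn0 : (0 : ℝ) < n := by exact_mod_cast h.n_pos
  have hθ := h.θ_pos
  have hs0 := abs_pos.mpr h.top_ne
  have hdn : (d : ℝ) + 1 ≤ n := by exact_mod_cast hd
  have h1 : 1 ≤ l * |roundPair x c s - round (s * y)| := by
    have h2 : (l : ℝ) * (roundPair x c s - round (s * y)) = ((z - l * round (s * y) : ℤ) : ℝ) := by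
      push_cast; rw [← hz]; ring
    have h3 : z - l * round (s * y) ≠ 0 := by
      intro h0
      rw [h0, Int.cast_zero] at h2
      exact hP ⟨_, sub_eq_zero.mp ((mul_eq_zero.mp h2).resolve_left hl0.ne')⟩
    rw [← abs_of_pos hl0, ← abs_mul, h2]
    exact_mod_cast Int.one_le_abs h3
  have h2 := abs_mul_sum_sub_roundPair_le hsx hc1
  have h3 : |s * (y - ∑ i, c i * x i)| ≤ n * θ := by
    rw [abs_mul]
    calc |s| * |y - ∑ i, c i * x i| ≤ |s₀| * (n * θ / |s₀|) :=
          mul_le_mul (h.le_top s hs) hyc (abs_nonneg _) hs0.le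
      _ = n * θ := by field_simp
  have h4 : roundPair x c s - round (s * y) = nerr (s * y) - s * (y - ∑ i, c i * x i) -
      (s * ∑ i, c i * x i - roundPair x c s) := by
    rw [nerr]; ring
  have h5 : |roundPair x c s - round (s * y)| ≤ 2 * n * |nerr (s * y)| := by
    rw [h4]
    have h6 := abs_sub (nerr (s * y) - s * (y - ∑ i, c i * x i))
      (s * ∑ i, c i * x i - roundPair x c s)
    have h7 := abs_sub (nerr (s * y)) (s * (y - ∑ i, c i * x i))
    have h8 : (d : ℝ) * 1 * θ ≤ (n - 1) * θ := by nlinarith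
    have h9 : (2 * n - 1) * θ ≤ (2 * n - 1) * |nerr (s * y)| :=
      mul_le_mul_of_nonneg_left hsy (by
        have : (0 : ℝ) ≤ d := by positivity
        linarith)
    linarith
  rw [div_le_iff₀ (by positivity)]
  nlinarith

/-- The lattices whose pairings are integral at most frequencies. -/
structure IsAdmissible (ν : Measure ℝ) (n : ℕ) (M θ : ℝ) (𝒯 : Set ℝ) {d : ℕ} (t x : Fin d → ℝ)
    (N : ℤ) (Λ : Submodule ℤ (Fin d → ℝ)) : Prop where
  lattice : IsOverlattice N Λ
  integral : ∀ c ∈ Λ, ∀ j, ∃ z : ℤ, roundPair x c (t j) = z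
  bad : ν.real (badSet 𝒯 θ x Λ) ≤
    1 / 25 + Real.log (cell Λ).ncard / Real.log (1 / (2 * n * θ)) / (400 * n)
  le : ((cell Λ).ncard : ℝ) ≤ M

lemma one_lt_ratio (h : IsNearIntegral ν W n T M θ β X s₀ 𝒯 A) : 1 < 1 / (2 * n * θ) := by
  have hn0 : (0 : ℝ) < n := by exact_mod_cast h.n_pos
  have hθ := h.θ_pos
  rw [lt_div_iff₀ (by positivity)]
  have := h.θ_le
  have : 0 < n * θ := by positivity
  linarith

lemma log_div_le (h : IsNearIntegral ν W n T M θ β X s₀ 𝒯 A) {I : ℕ} (hI : 0 < I)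
    (hIM : (I : ℝ) ≤ M) : Real.log I / Real.log (1 / (2 * n * θ)) / (400 * n) ≤ 1 / 400 := by
  have hn0 : (0 : ℝ) < n := by exact_mod_cast h.n_pos
  have hθ := h.θ_pos
  have hL := Real.log_pos h.one_lt_ratio
  have h1 : (I : ℝ) ≤ (1 / (2 * n * θ)) ^ n := by
    refine hIM.trans (h.lt_pow.le.trans ?_)
    gcongr
    refine (Nat.floor_le (by positivity)).trans ?_
    gcongr
    norm_num
  have h2 := Real.log_le_log (by exact_mod_cast hI) h1
  rw [Real.log_pow] at h2
  rw [div_div, div_le_div_iff₀ (by positivity) (by positivity)]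
  nlinarith

lemma one_le_floor (h : IsNearIntegral ν W n T M θ β X s₀ 𝒯 A) : 1 ≤ ⌊1 / (16 * n * θ)⌋₊ := by
  have hn0 : (0 : ℝ) < n := by exact_mod_cast h.n_pos
  have hθ := h.θ_pos
  refine Nat.le_floor ?_
  rw [Nat.cast_one, le_div_iff₀ (by positivity)]
  linarith [h.θ_le]

lemma IsAdmissible.intLattice [IsProbabilityMeasure ν]
    (h : IsNearIntegral ν W n T M θ β X s₀ 𝒯 A) {d : ℕ} (hd : d < n)
    {t x : Fin d → ℝ} (hf : IsFrame 𝒯 A θ t x) {N : ℤ} (hN : N ≠ 0) :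
    IsAdmissible ν n M θ 𝒯 t x N (intLattice d) := by
  have hbad := h.badSet_intLattice_le hd.le hf.pt_mem
  have hInt : ∀ c ∈ _root_.intLattice d, ∀ j, ∃ z : ℤ, roundPair x c (t j) = z :=
    fun c hc j => roundPair_intLattice x hc _
  have hlat := intLattice_isOverlattice d N
  refine ⟨hlat, hInt, hbad.trans ?_, ?_⟩
  · have := Real.log_pos h.one_lt_ratio
    have h2 : (1 : ℝ) ≤ (cell (_root_.intLattice d)).ncard := by
      exact_mod_cast hlat.ncard_cell_pos hN
    have := Real.log_nonneg h2
    have : 0 ≤ Real.log (cell (_root_.intLattice d)).ncard / Real.log (1 / (2 * n * θ)) / (400 * n) := by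
      positivity
    linarith
  · have h1 := h.card_le hd.le hf hN hlat hInt (hbad.trans (by norm_num)) (k := 1) (by
      intro i hi
      obtain rfl : i = 0 := by omega
      have := abs_pos.mpr h.top_ne
      simp)
    refine le_trans ?_ h1
    rw [mul_one]
    exact_mod_cast Nat.le_mul_of_pos_left _ (pow_pos h.one_le_floor d)

/-- Adjoining a vector with integral pairings keeps a lattice admissible. -/
lemma IsAdmissible.sup_span [IsProbabilityMeasure ν]
    (h : IsNearIntegral ν W n T M θ β X s₀ 𝒯 A) {d : ℕ} (hd : d < n)
    {t x : Fin d → ℝ} (hf : IsFrame 𝒯 A θ t x) {N : ℤ} (hN : N ≠ 0)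
    {Λ : Submodule ℤ (Fin d → ℝ)} (hΛ : IsAdmissible ν n M θ 𝒯 t x N Λ)
    {c : Fin d → ℝ} {y : ℝ} (hyA : y ∈ A) (hcΛ : c ∉ Λ) (hc1 : ∀ i, |c i| ≤ 1)
    (hcN : ∀ i, ∃ k : ℤ, (N : ℝ) * c i = k) (hct : ∀ j, roundPair x c (t j) = round (t j * y))
    (hround : ∀ s ∈ 𝒯, (∀ i, |nerr (s * x i)| ≤ θ) → |nerr (s * y)| ≤ θ →
      (round (s * y) : ℝ) = roundPair x c s)
    (hyc : |y - ∑ i, c i * x i| ≤ n * θ / |s₀|) :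
    IsAdmissible ν n M θ 𝒯 t x N (Λ ⊔ Submodule.span ℤ {c}) ∧
      (cell Λ).ncard < (cell (Λ ⊔ Submodule.span ℤ {c})).ncard := by
  classical
  have hn0 : (0 : ℝ) < n := by exact_mod_cast h.n_pos
  have hθ := h.θ_pos
  have hL := Real.log_pos h.one_lt_ratio
  have hex : ∃ l : ℕ, 0 < l ∧ (l : ℤ) • c ∈ Λ := by
    refine ⟨N.natAbs, Int.natAbs_pos.mpr hN, ?_⟩
    choose k hk using hcN
    have h1 : N • c ∈ Λ := by
      have h2 : N • c = intVec k := by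
        funext i
        rw [Pi.smul_apply, zsmul_eq_mul, hk]
        rfl
      rw [h2]
      exact hΛ.lattice.intVec_mem k
    rcases Int.natAbs_eq N with h2 | h2
    · rwa [← h2]
    · have h3 : ((N.natAbs : ℕ) : ℤ) = -N := by omega
      rw [h3, neg_smul]
      exact Λ.neg_mem h1
  obtain ⟨l, ⟨hl0, hlc⟩, hlmin⟩ : ∃ l : ℕ, (0 < l ∧ (l : ℤ) • c ∈ Λ) ∧
      ∀ j : ℕ, 0 < j → j < l → (j : ℤ) • c ∉ Λ :=
    ⟨Nat.find hex, Nat.find_spec hex, fun j hj hjl hjc => Nat.find_min hex hjl ⟨hj, hjc⟩⟩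
  have hl2 : 2 ≤ l := by
    by_contra hlt
    obtain rfl : l = 1 := by omega
    rw [Nat.cast_one, one_smul] at hlc
    exact hcΛ hlc
  set Λ' := Λ ⊔ Submodule.span ℤ {c} with hΛ'
  have hlat : IsOverlattice N Λ' := hΛ.lattice.sup_span hcN
  have hcard : l * (cell Λ).ncard ≤ (cell Λ').ncard := hΛ.lattice.mul_ncard_cell_le hN hcN hlmin
  have hI0 := hΛ.lattice.ncard_cell_pos hN
  have hl2' : (2 : ℝ) ≤ l := by exact_mod_cast hl2
  have hInt : ∀ v ∈ Λ', ∀ j, ∃ z : ℤ, roundPair x v (t j) = z := fun v hv j =>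
    roundPair_sup_span (fun u hu => hΛ.integral u hu j) ⟨_, hct j⟩ v hv
  have hjunk : badSet 𝒯 θ x Λ' ⊆ badSet 𝒯 θ x Λ ∪
      ({s | ¬ |nerr (s * y)| ≤ θ} ∩ {s | 1 / (2 * n * l) ≤ |nerr (s * y)|}) := by
    intro s hs
    by_cases hsb : s ∈ badSet 𝒯 θ x Λ
    · exact Or.inl hsb
    right
    simp only [badSet, Set.mem_ofPred_eq, not_not] at hsb hs
    obtain ⟨hs1, hs2, hs3⟩ := hsb
    have hP : ¬ ∃ z : ℤ, roundPair x c s = z := fun hz =>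
      hs ⟨hs1, hs2, roundPair_sup_span hs3 hz⟩
    have hsy : ¬ |nerr (s * y)| ≤ θ := fun hle => hP ⟨_, (hround s hs1 hs2 hle).symm⟩
    refine ⟨hsy, h.le_abs_nerr hd hl0 hc1 hyc hs1 hs2 ?_ hP (not_le.mp hsy).le⟩
    obtain ⟨z, hz⟩ := hs3 _ hlc
    refine ⟨z, ?_⟩
    rw [← hz, roundPair, roundPair, Finset.mul_sum]
    refine Finset.sum_congr rfl fun i _ => ?_
    simp [mul_assoc]
  have hbad : ν.real (badSet 𝒯 θ x Λ') ≤ ν.real (badSet 𝒯 θ x Λ) +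
      min 1 ((l / (1 / (2 * n * θ))) ^ 2) / (400 * n) := by
    refine (measureReal_mono hjunk).trans ((measureReal_union_le _ _).trans ?_)
    gcongr
    rcases min_choice 1 (((l : ℝ) / (1 / (2 * n * θ))) ^ 2) with hmin | hmin <;> rw [hmin]
    · exact (measureReal_mono Set.inter_subset_left).trans (h.nerr_lt_le hyA)
    · refine (measureReal_mono Set.inter_subset_right).trans
        ((h.nerr_le hyA (by positivity)).trans (le_of_eq ?_))
      field_simp
  have hlog := min_one_sq_div_le hl2' h.one_lt_ratio
  have hlogI := h.log_div_le hI0 hΛ.le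
  have hbad1 := hΛ.bad
  have hmin1 : min 1 (((l : ℝ) / (1 / (2 * n * θ))) ^ 2) / (400 * (n : ℝ)) ≤ 1 / 400 := by
    rw [div_le_div_iff₀ (by positivity) (by positivity)]
    have h1 := min_le_left 1 (((l : ℝ) / (1 / (2 * n * θ))) ^ 2)
    have h2 : (1 : ℝ) ≤ n := by exact_mod_cast h.n_pos
    linarith
  have hM : ((cell Λ').ncard : ℝ) ≤ M := by
    have h1 := h.card_le hd.le hf hN hlat hInt (by linarith) (k := 1) (by
      intro i hi
      obtain rfl : i = 0 := by omega
      have := abs_pos.mpr h.top_ne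
      simp)
    refine le_trans ?_ h1
    rw [mul_one]
    exact_mod_cast Nat.le_mul_of_pos_left _ (pow_pos h.one_le_floor d)
  refine ⟨⟨hlat, hInt, ?_, hM⟩, by nlinarith⟩
  have h1 : Real.log l + Real.log (cell Λ).ncard ≤ Real.log (cell Λ').ncard := by
    rw [← Real.log_mul (by positivity) (by positivity)]
    exact Real.log_le_log (by positivity) (by exact_mod_cast hcard)
  have h2 : Real.log l / Real.log (1 / (2 * n * θ)) / (400 * n) +
      Real.log (cell Λ).ncard / Real.log (1 / (2 * n * θ)) / (400 * n) ≤
      Real.log (cell Λ').ncard / Real.log (1 / (2 * n * θ)) / (400 * n) := by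
    rw [← add_div, ← add_div]
    gcongr
  have h3 : min 1 (((l : ℝ) / (1 / (2 * n * θ))) ^ 2) / (400 * (n : ℝ)) ≤
      Real.log l / Real.log (1 / (2 * n * θ)) / (400 * n) := by
    gcongr
  linarith

/-- Most points are close to a small lattice structure. -/
theorem exists_lattice [IsProbabilityMeasure ν] [IsProbabilityMeasure W]
    (h : IsNearIntegral ν W n T M θ β X s₀ 𝒯 A) (hβ : 0 ≤ β) :
    ∃ d < n, ∃ x : Fin d → ℝ, (∀ i, |x i| ≤ X) ∧ ∃ (N : ℤ) (Λ : Submodule ℤ (Fin d → ℝ)),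
      N ≠ 0 ∧ IsOverlattice N Λ ∧
      W.real {y | ¬ ∃ c ∈ cube Λ, |y - ∑ i, c i * x i| ≤ n * θ / |s₀|} ≤ β / 2 ∧
      (⌊1 / (16 * n * θ)⌋₊ : ℝ) ^ d * (cell Λ).ncard ≤ M ∧
      (⌊1 / (16 * n * θ)⌋₊ : ℝ) ^ d * (cell Λ).ncard * (T / (8 * |s₀|)) ≤ M := by
  have hn0 : (0 : ℝ) < n := by exact_mod_cast h.n_pos
  have hs0 := abs_pos.mpr h.top_ne
  have hT := h.T_pos
  obtain ⟨d, hd, t, x, hf, hmax, hext⟩ := h.exists_max_frame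
  set N := (roundMat t x).det with hN
  have hN0 : N ≠ 0 := hf.det_ne
  set S : Set ℕ := {k | ∃ Λ, IsAdmissible ν n M θ 𝒯 t x N Λ ∧ k = (cell Λ).ncard} with hS
  have hSne : S.Nonempty := ⟨_, _, IsAdmissible.intLattice h hd hf hN0, rfl⟩
  have hSb : BddAbove S := by
    refine ⟨⌊M⌋₊, ?_⟩
    rintro _ ⟨Λ, hΛ, rfl⟩
    exact Nat.le_floor hΛ.le
  obtain ⟨Λ, hΛ, hmaxΛ⟩ := Nat.sSup_mem hSne hSb
  have hI0 := hΛ.lattice.ncard_cell_pos hN0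
  refine ⟨d, hd, x, fun i => h.pts_le _ (hf.pt_mem i), N, Λ, hN0, hΛ.lattice, ?_, ?_⟩
  · have hsub : {y | ¬ ∃ c ∈ cube Λ, |y - ∑ i, c i * x i| ≤ n * θ / |s₀|} ⊆
        {y | ¬ (y ∈ A ∧ ∀ j, |nerr (t j * y)| ≤ θ)} := by
      intro y hy hyA
      refine hy ?_
      obtain ⟨c, hc1, hcN, hct, hround, hyc⟩ := h.exists_coeff hd hf hmax hext hyA.1 hyA.2
      refine ⟨c, ⟨?_, hc1⟩, hyc⟩
      by_contra hcΛ
      obtain ⟨hadm, hlt⟩ := IsAdmissible.sup_span h hd hf hN0 hΛ hyA.1 hcΛ hc1 hcN hct hround hyc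
      have := le_csSup hSb ⟨_, hadm, rfl⟩
      omega
    refine (measureReal_mono hsub).trans ((measureReal_compl_forall_le (b := β / (64 * n)) h.pts
      fun j => ?_).trans ?_)
    · simpa only [not_le] using h.freq_nerr _ (hf.freq_mem j)
    · have hdn : (d : ℝ) ≤ n := by exact_mod_cast hd.le
      have : (d : ℝ) * (β / (64 * n)) ≤ n * (β / (64 * n)) := by gcongr
      have h2 : (n : ℝ) * (β / (64 * n)) = β / 64 := by field_simp
      linarith
  · have hbad : ν.real (badSet 𝒯 θ x Λ) ≤ 1 / 10 := by
      have h1 := h.log_div_le hI0 hΛ.le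
      have h2 := hΛ.bad
      linarith
    have h1 := h.card_le hd.le hf hN0 hΛ.lattice hΛ.integral hbad
      (k := ⌊T / (8 * |s₀|)⌋₊ + 1) (by
        intro i hi
        have h2 : (i : ℝ) ≤ T / (8 * |s₀|) :=
          (Nat.cast_le.mpr (Nat.lt_succ_iff.mp hi)).trans (Nat.floor_le (by positivity))
        rw [div_le_iff₀ (by positivity)]
        refine h2.trans (le_of_eq ?_)
        field_simp
        norm_num)
    push_cast at h1
    have h2 := Nat.lt_floor_add_one (T / (8 * |s₀|))
    have h3 : (0 : ℝ) ≤ (⌊1 / (16 * n * θ)⌋₊ : ℝ) ^ d * (cell Λ).ncard := by positivity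
    have h4 : (0 : ℝ) ≤ (⌊T / (8 * |s₀|)⌋₊ : ℝ) := by positivity
    constructor
    · refine le_trans ?_ h1
      exact le_mul_of_one_le_right h3 (by linarith)
    · exact le_trans (mul_le_mul_of_nonneg_left h2.le h3) h1

end IsNearIntegral

lemma measureReal_not_le_le {M : Measure ℝ} [IsFiniteMeasure M] {f : ℝ → ℝ}
    (hf : Integrable f M) (hf0 : ∀ x, 0 ≤ f x) {K c : ℝ} (hc : 0 < c) (hK : ∫ x, f x ∂M ≤ K) :
    M.real {x | ¬ f x ≤ c} ≤ K / c := by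
  rw [le_div_iff₀ hc, mul_comm]
  refine le_trans ?_ ((mul_meas_ge_le_integral_of_nonneg
    (Filter.Eventually.of_forall hf0) hf c).trans hK)
  refine mul_le_mul_of_nonneg_left (measureReal_mono fun x hx => ?_) hc.le
  simp only [Set.mem_ofPred_eq] at hx ⊢
  exact (not_le.mp hx).le

lemma exists_isNearIntegral {ν W : Measure ℝ} [IsProbabilityMeasure ν] [IsProbabilityMeasure W]
    {n : ℕ} {T M θ β X q H : ℝ} (hn : 0 < n) (hT : 0 < T) (hq : 0 < q)
    (hν : ν ≤ ENNReal.ofReal q • (volume.restrict (Set.Icc (-T) T)))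
    (hsieve : ∀ Z : Finset ℝ, (∀ z ∈ Z, ∀ w ∈ Z, z ≠ w → 1 / (2 * T) ≤ |z - w|) →
      (∀ z ∈ Z, 1 / 2 ≤ ∫ t, Real.cos (2 * Real.pi * (t * z)) ∂ν) → (#Z : ℝ) ≤ M)
    (hβ : 0 < β) (hθ : 0 < θ) (hθH : θ ^ 2 = 6400 * n * H) (hθn : 16 * n * θ ≤ 1)
    (hM : M < (⌊1 / (16 * n * θ)⌋₊ : ℝ) ^ n)
    (hH : ∫ t, ∫ x, nerr (t * x) ^ 2 ∂W ∂ν ≤ H * β) (hX : W.real {x | ¬ |x| ≤ X} ≤ β / 16) :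
    ∃ s₀ 𝒯 A, IsNearIntegral ν W n T M θ β X s₀ 𝒯 A := by
  have hn0 : (0 : ℝ) < n := by exact_mod_cast hn
  have hn1 : (1 : ℝ) ≤ n := by exact_mod_cast hn
  have hH0 : 0 < H := by
    by_contra hneg
    have : 6400 * (n : ℝ) * H ≤ 0 := mul_nonpos_of_nonneg_of_nonpos (by positivity) (not_lt.mp hneg)
    have := pow_pos hθ 2
    linarith
  set S : Set ℝ := {t | ∫ x, nerr (t * x) ^ 2 ∂W ≤ 100 * (H * β)} with hS
  have hSm : ν.real Sᶜ ≤ 1 / 100 := by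
    have h1 := measureReal_not_le_le (M := ν) (nerr_sq_integrable_prod (N := W)).integral_prod_left
      (fun t => integral_nonneg fun x => sq_nonneg _) (c := 100 * (H * β)) (by positivity) hH
    refine h1.trans (le_of_eq ?_)
    field_simp
  obtain ⟨s₀, hs₀, hs₀0, hs₀T, hbad⟩ := exists_top_frequency hq hν hSm
  have hSnerr : ∀ t ∈ S, W.real {x | θ < |nerr (t * x)|} ≤ β / (64 * n) := by
    intro t ht
    refine (measureReal_nerr_lt_le (by fun_prop) hθ ht).trans (le_of_eq ?_)
    rw [hθH]
    field_simp
    norm_num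
  set A₁ : Set ℝ := {x | ∫ t, nerr (t * x) ^ 2 ∂ν ≤ 16 * H} with hA₁
  have hA₁m : W.real A₁ᶜ ≤ β / 16 := by
    have hInt : Integrable (fun z : ℝ × ℝ => nerr (z.2 * z.1) ^ 2) (W.prod ν) := by
      simpa only [mul_comm] using nerr_sq_integrable_prod (M := W) (N := ν)
    have h0 : ∫ x, ∫ t, nerr (t * x) ^ 2 ∂ν ∂W ≤ H * β := by
      rw [integral_integral_swap hInt]
      exact hH
    have h1 := measureReal_not_le_le (M := W) hInt.integral_prod_left
      (fun t => integral_nonneg fun x => sq_nonneg _) (c := 16 * H) (by positivity) h0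
    refine h1.trans (le_of_eq ?_)
    field_simp
  set A : Set ℝ := {x | |x| ≤ X} ∩ A₁ ∩ {x | |nerr (s₀ * x)| ≤ θ} with hA
  refine ⟨s₀, {t | t ∈ S ∧ |t| ≤ |s₀|}, A, ?_⟩
  have hAm : W.real Aᶜ ≤ β / 4 := by
    rw [hA, Set.compl_inter, Set.compl_inter]
    have h1 := measureReal_union_le (μ := W) ({x | |x| ≤ X}ᶜ ∪ A₁ᶜ) {x | |nerr (s₀ * x)| ≤ θ}ᶜ
    have h2 := measureReal_union_le (μ := W) {x | |x| ≤ X}ᶜ A₁ᶜ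
    have h3 : W.real {x | |nerr (s₀ * x)| ≤ θ}ᶜ ≤ β / (64 * n) := by
      have h4 := hSnerr s₀ hs₀
      simp only [← not_le] at h4
      exact h4
    have h4 : W.real {x | |x| ≤ X}ᶜ ≤ β / 16 := hX
    have h5 : β / (64 * n) ≤ β / 64 := by
      gcongr
      linarith
    linarith
  exact
    { n_pos := hn
      T_pos := hT
      θ_pos := hθ
      θ_le := hθn
      sieve := hsieve
      top_mem := ⟨hs₀, le_rfl⟩
      top_ne := hs₀0
      top_le := hs₀T
      le_top := fun t ht => ht.2
      freq := hbad
      pts := hAm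
      freq_nerr := fun t ht => hSnerr t ht.1
      pts_le := fun x hx => hx.1.1
      pts_nerr := fun x hx => by
        refine hx.1.2.trans (le_of_eq ?_)
        rw [hθH]
        field_simp
        norm_num
      pts_top := fun x hx => hx.2
      lt_pow := hM }

/-- The points of the cube `[-1, 1]^d` whose coordinates have denominator `m` factorial. -/
def factorialGrid (d m : ℕ) : Set (Fin d → ℝ) :=
  {c | (∀ i, |c i| ≤ 1) ∧ ∀ i, ∃ k : ℤ, (m.factorial : ℝ) * c i = k}

lemma factorialGrid_finite (d m : ℕ) : (factorialGrid d m).Finite :=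
  finite_of_denom (N := (m.factorial : ℤ)) (by exact_mod_cast m.factorial_ne_zero)
    (fun c hc i => by simpa using hc.2 i) fun _ hc => hc.1

/-- Most of `W` is close to a bounded linear image of a small set `C` of coefficients, and this
neighborhood is within `1 / T` of a CGAP. -/
structure IsCaptured (W : Measure ℝ) (r m : ℕ) (β X T : ℝ) {d : ℕ} (C : Set (Fin d → ℝ))
    (x : Fin d → ℝ) (ε : ℝ) : Prop where
  rank_le : d ≤ r
  isCGAP : ∀ h : Fin d → ℝ, IsCGAP d m ((fun c => ∑ i, c i * h i) '' C)
  subset_grid : C ⊆ factorialGrid d m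
  abs_le : ∀ i, |x i| ≤ X
  le : ε ≤ m / T
  near : W.real {y | ¬ ∃ c ∈ C, |y - ∑ i, c i * x i| ≤ ε} ≤ β / 2
  cover : ∃ K, IsCGAP r m K ∧ ∀ c ∈ C, ∀ y, |y - ∑ i, c i * x i| ≤ ε → ∃ z ∈ K, |y - z| ≤ 1 / T

lemma exists_cover {r m d : ℕ} {C : Set (Fin d → ℝ)} {x : Fin d → ℝ} {m' : ℕ} {T ε : ℝ}
    (hT : 0 < T) (hdr : d < r) (h : IsCGAP d m' ((fun c => ∑ i, c i * x i) '' C))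
    (hm : m' * (2 * ⌈ε * T⌉₊ + 1) ≤ m) :
    ∃ K, IsCGAP r m K ∧ ∀ c ∈ C, ∀ y, |y - ∑ i, c i * x i| ≤ ε → ∃ z ∈ K, |y - z| ≤ 1 / T := by
  refine ⟨_, ((h.succ (1 / T) ⌈ε * T⌉₊).mono_card hm).mono_rank hdr, fun c hc y hy => ?_⟩
  set z₀ := ∑ i, c i * x i
  set u := (y - z₀) * T with hu
  have hu1 : |u| ≤ ⌈ε * T⌉₊ := by
    rw [hu, abs_mul, abs_of_pos hT]
    exact (mul_le_mul_of_nonneg_right hy hT.le).trans (Nat.le_ceil _)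
  refine ⟨z₀ + ⌊u⌋ * (1 / T), ⟨z₀, ⟨c, hc, rfl⟩, ⌊u⌋, ?_, rfl⟩, ?_⟩
  · rw [abs_le] at hu1 ⊢
    constructor
    · exact Int.le_floor.mpr (by push_cast; exact hu1.1)
    · have := (Int.floor_le u).trans hu1.2
      exact_mod_cast this
  · have h1 : y - (z₀ + ⌊u⌋ * (1 / T)) = Int.fract u / T := by
      rw [← Int.self_sub_floor, hu]
      field_simp
      ring
    rw [h1, abs_div, abs_of_nonneg (Int.fract_nonneg u), abs_of_pos hT]
    gcongr
    exact (Int.fract_lt_one u).le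

lemma sq_le_four_pow (n : ℕ) : (n : ℝ) ^ 2 ≤ 4 ^ n := by
  have h : (n : ℝ) ≤ 2 ^ n := by exact_mod_cast Nat.lt_two_pow_self.le
  calc (n : ℝ) ^ 2 ≤ (2 ^ n) ^ 2 := by gcongr
    _ = 4 ^ n := by rw [← pow_mul, mul_comm, pow_mul]; norm_num

set_option maxHeartbeats 1000000 in
/-- Either the averaged characteristic function is small or `W` is captured. -/
lemma triMean_le_or_isCaptured {W : Measure ℝ} [IsProbabilityMeasure W] {C₀ : ℝ} (hC₀ : 1 ≤ C₀)
    (hsieve : ∀ (T p : ℝ) (ν : Measure ℝ), 0 < T → 0 < p → IsProbabilityMeasure ν →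
      ν ≤ ENNReal.ofReal (1 / (p * T)) • (volume.restrict (Set.Icc (-T) T)) →
      ∀ Z : Finset ℝ, (∀ z ∈ Z, ∀ w ∈ Z, z ≠ w → 1 / (2 * T) ≤ |z - w|) →
      (∀ z ∈ Z, 1 / 2 ≤ ∫ t, Real.cos (2 * Real.pi * (t * z)) ∂ν) → (#Z : ℝ) ≤ C₀ / p)
    {T a β X : ℝ} (hT : 0 < T) (ha : 0 < a) (hβ : 0 < β) {r m : ℕ} (hm : 0 < m)
    (hX : W.real {x | ¬ |x| ≤ X} ≤ β / 16)
    (hInt : 1 / T * ∫ t in (-T)..T, (1 - |t| / T) * Real.exp (-a * cosDef W t) * cosDef W t ≤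
        2 * (r + 1 : ℕ) / a * triMean W T a) :
    triMean W T a * √(a * β) ^ (r + 1) ≤ (15360 * C₀ * ((r : ℝ) + 1) ^ 2) ^ (r + 1) ∨
    triMean W T a * √(a * β) * m ≤ (15360 * C₀) ^ (r + 1) ∨
    ∃ (d : ℕ) (C : Set (Fin d → ℝ)) (x : Fin d → ℝ) (ε : ℝ), IsCaptured W r m β X T C x ε := by
  obtain ⟨n, hn⟩ : ∃ n, n = r + 1 := ⟨_, rfl⟩
  have hnr : (r : ℝ) + 1 = n := by rw [hn]; push_cast; ring
  rw [← hn] at hInt ⊢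
  rw [hnr]
  have hn0 : 0 < n := by omega
  have hn1 : (1 : ℝ) ≤ n := by exact_mod_cast hn0
  set p := triMean W T a with hp
  have hp0 : 0 < p := triMean_pos W hT ha.le
  have hp1 : p ≤ 1 := triMean_le_one W hT ha.le
  set κ := √(a * β) with hκ
  have hκ0 : 0 < κ := Real.sqrt_pos.mpr (by positivity)
  have hκ2 : κ ^ 2 = a * β := Real.sq_sqrt (by positivity)
  have hsmall : p * κ ^ n ≤ C₀ * (1280 * (n : ℝ) ^ 2) ^ n →
      p * κ ^ n ≤ (15360 * C₀ * (n : ℝ) ^ 2) ^ n := by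
    intro h
    refine h.trans ?_
    calc C₀ * (1280 * (n : ℝ) ^ 2) ^ n ≤ C₀ ^ n * (1280 * (n : ℝ) ^ 2) ^ n := by
          gcongr
          exact le_self_pow₀ hC₀ hn0.ne'
      _ = (1280 * C₀ * (n : ℝ) ^ 2) ^ n := by rw [← mul_pow]; ring
      _ ≤ (15360 * C₀ * (n : ℝ) ^ 2) ^ n := by gcongr; norm_num
  rcases lt_or_ge κ (640 * (n : ℝ) ^ 2) with hlt | hge
  · left
    refine hsmall ?_
    calc p * κ ^ n ≤ 1 * (1280 * (n : ℝ) ^ 2) ^ n := by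
          have : κ ≤ 1280 * (n : ℝ) ^ 2 := by nlinarith [sq_nonneg (n : ℝ)]
          gcongr
      _ ≤ C₀ * (1280 * (n : ℝ) ^ 2) ^ n := by gcongr
  set θ := 40 * n / κ with hθ
  have hθ0 : 0 < θ := by positivity
  set J := ⌊1 / (16 * n * θ)⌋₊ with hJ
  have hu : 1 / (16 * n * θ) = κ / (640 * (n : ℝ) ^ 2) := by
    rw [hθ]; field_simp; norm_num
  have hu1 : 1 ≤ κ / (640 * (n : ℝ) ^ 2) := by
    rw [le_div_iff₀ (by positivity)]; linarith
  have hJle : (J : ℝ) ≤ κ / (640 * (n : ℝ) ^ 2) := by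
    rw [hJ, hu]; exact Nat.floor_le (by positivity)
  have hJ1 : (1 : ℝ) ≤ J := by
    have : 1 ≤ J := by
      rw [hJ, hu]; exact Nat.le_floor (by simpa using hu1)
    exact_mod_cast this
  have hκJ : κ ≤ 1280 * (n : ℝ) ^ 2 * J := by
    have h1 : κ / (640 * (n : ℝ) ^ 2) < J + 1 := by
      rw [hJ, hu]; exact Nat.lt_floor_add_one _
    rw [div_lt_iff₀ (by positivity)] at h1
    nlinarith [sq_nonneg (n : ℝ)]
  have hpow : p * (J : ℝ) ^ n ≤ C₀ → p * κ ^ n ≤ (15360 * C₀ * (n : ℝ) ^ 2) ^ n := by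
    intro h
    refine hsmall ?_
    calc p * κ ^ n ≤ p * (1280 * (n : ℝ) ^ 2 * J) ^ n := by gcongr
      _ = p * (J : ℝ) ^ n * (1280 * (n : ℝ) ^ 2) ^ n := by rw [mul_pow]; ring
      _ ≤ C₀ * (1280 * (n : ℝ) ^ 2) ^ n := by gcongr
  rcases le_or_gt ((J : ℝ) ^ n) (C₀ / p) with hM | hM
  · left
    refine hpow ?_
    rw [le_div_iff₀ hp0] at hM
    linarith
  obtain ⟨ν, hνp, hν, hνint⟩ := exists_tilt W ha hT hInt
  obtain ⟨s₀, 𝒯, A, hA⟩ := exists_isNearIntegral (ν := ν) (W := W) (n := n) (θ := θ) (X := X)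
    (H := n / (4 * a) / β) (M := C₀ / p) hn0 hT (by positivity) hν
    (hsieve T p ν hT hp0 hνp hν) hβ hθ0 (by rw [hθ, div_pow, hκ2]; field_simp; norm_num)
    (by
      have h2 : 16 * n * θ = 1 / (κ / (640 * (n : ℝ) ^ 2)) := by rw [← hu, one_div_one_div]
      rw [h2, div_le_one (by linarith)]
      exact hu1) hM (hνint.trans (le_of_eq (by field_simp))) hX
  obtain ⟨d, hd, x, hx, N, Λ, hN, hΛ, hW, hM1, hM2⟩ := hA.exists_lattice hβ.le
  rw [← hJ] at hM1 hM2
  have hs₀ := abs_pos.mpr hA.top_ne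
  set I := (cell Λ).ncard with hI
  have hI1 : (1 : ℝ) ≤ I := by exact_mod_cast hΛ.ncard_cell_pos hN
  set ε := n * θ / |s₀| with hε
  have hε0 : 0 < ε := by positivity
  rw [le_div_iff₀ hp0] at hM1 hM2
  -- the second count, in terms of the number of steps
  have hM3 : (J : ℝ) ^ (d + 1) * I * (2 * (ε * T)) * p ≤ C₀ := by
    refine le_trans ?_ hM2
    have h1 : (J : ℝ) * (2 * (ε * T)) ≤ T / (8 * |s₀|) := by
      calc (J : ℝ) * (2 * (ε * T)) ≤ κ / (640 * (n : ℝ) ^ 2) * (2 * (ε * T)) := by gcongr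
        _ = T / (8 * |s₀|) := by rw [hε, hθ]; field_simp; norm_num
    calc (J : ℝ) ^ (d + 1) * I * (2 * (ε * T)) * p = (J : ℝ) ^ d * I * (J * (2 * (ε * T))) * p := by
          ring
      _ ≤ (J : ℝ) ^ d * I * (T / (8 * |s₀|)) * p := by gcongr
  have hd' : (3 : ℝ) ^ d ≤ 3 ^ n := pow_le_pow_right₀ (by norm_num) hd.le
  have hcount : (m : ℝ) ≤ 3 * 3 ^ d * C₀ / (J * p) →
      p * κ * m ≤ (15360 * C₀) ^ n := by
    intro h
    rw [le_div_iff₀ (by positivity)] at h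
    have h3 : (3 : ℝ) * 3 ^ d ≤ 3 ^ n := by
      rw [← pow_succ']
      exact pow_le_pow_right₀ (by norm_num) hd
    calc p * κ * m ≤ p * (1280 * (n : ℝ) ^ 2 * J) * m := by gcongr
      _ = 1280 * (n : ℝ) ^ 2 * (m * (J * p)) := by ring
      _ ≤ 1280 * 4 ^ n * (3 * 3 ^ d * C₀) := by
          gcongr
          exact sq_le_four_pow n
      _ ≤ 1280 ^ n * 4 ^ n * (3 ^ n * C₀ ^ n) := by
          gcongr
          · exact le_self_pow₀ (by norm_num) hn0.ne'
          · exact le_self_pow₀ hC₀ hn0.ne'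
      _ = (15360 * C₀) ^ n := by
          rw [← mul_pow, ← mul_pow, ← mul_pow]
          ring
  have hgrid : 3 ^ d * I ≤ m → cube Λ ⊆ factorialGrid d m := by
    intro h3 c hc
    refine ⟨hc.2, fun i => hΛ.exists_factorial_mul hN (le_trans ?_ h3) hc.1 i⟩
    exact Nat.le_mul_of_pos_left _ (by positivity)
  have hm1 : (1 : ℝ) ≤ m := by exact_mod_cast hm
  rcases le_or_gt (ε * T) 1 with hρ | hρ
  · rcases le_or_gt (3 ^ d * I) m with h3 | h3
    · right; right
      have hcg := hΛ.isCGAP hN h3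
      have hεT : ε ≤ 1 / T := by rw [le_div_iff₀ hT]; exact hρ
      refine ⟨d, cube Λ, x, ε, by omega, hcg, hgrid h3, hx, hεT.trans (by gcongr), hW,
        _, (hcg x).mono_rank (by omega), fun c hc y hy => ⟨_, ⟨c, hc, rfl⟩, hy.trans hεT⟩⟩
    · right; left
      refine hcount ?_
      have hd0 : d ≠ 0 := by
        rintro rfl
        have hIle : I ≤ 1 := Set.ncard_le_one_of_subsingleton _
        simp at h3
        omega
      have h4 : (m : ℝ) ≤ 3 ^ d * I := by exact_mod_cast h3.le
      have h5 : (J : ℝ) ≤ (J : ℝ) ^ d := le_self_pow₀ hJ1 hd0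
      rw [le_div_iff₀ (by positivity)]
      calc (m : ℝ) * (J * p) ≤ (3 ^ d * I) * ((J : ℝ) ^ d * p) := by gcongr
        _ = 3 ^ d * ((J : ℝ) ^ d * I * p) := by ring
        _ ≤ 3 ^ d * C₀ := by gcongr
        _ ≤ 3 * 3 ^ d * C₀ := by
            have : 0 ≤ (3 : ℝ) ^ d * C₀ := by positivity
            linarith
  · have hceil : (2 * ⌈ε * T⌉₊ + 1 : ℝ) ≤ 5 * (ε * T) := by
      have := Nat.ceil_lt_add_one (show 0 ≤ ε * T by positivity)
      linarith
    by_cases hdr : d = r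
    · left
      refine hpow ?_
      rw [hdr, ← hn] at hM3
      refine le_trans ?_ hM3
      have h1 : 1 ≤ (I : ℝ) * (2 * (ε * T)) := by nlinarith
      calc p * (J : ℝ) ^ n = (J : ℝ) ^ n * p * 1 := by ring
        _ ≤ (J : ℝ) ^ n * p * (I * (2 * (ε * T))) := by gcongr
        _ = _ := by ring
    have hdr' : d < r := by omega
    rcases le_or_gt (3 ^ d * I * (2 * ⌈ε * T⌉₊ + 1)) m with h3 | h3
    · right; right
      have h4 : 3 ^ d * I ≤ m := (Nat.le_mul_of_pos_right _ (by omega)).trans h3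
      refine ⟨d, cube Λ, x, ε, hdr'.le, hΛ.isCGAP hN h4, hgrid h4, hx, ?_, hW,
        exists_cover hT hdr' (hΛ.isCGAP hN le_rfl x) h3⟩
      rw [le_div_iff₀ hT]
      refine (Nat.le_ceil _).trans ?_
      have h5 : 0 < 3 ^ d * I := Nat.mul_pos (by positivity) (hΛ.ncard_cell_pos hN)
      have h6 : ⌈ε * T⌉₊ ≤ m := by nlinarith
      exact_mod_cast h6
    · right; left
      refine hcount ?_
      have h4 : (m : ℝ) ≤ 3 ^ d * I * (5 * (ε * T)) := by
        have : (m : ℝ) ≤ 3 ^ d * I * (2 * ⌈ε * T⌉₊ + 1) := by exact_mod_cast h3.le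
        exact this.trans (by gcongr)
      have h5 : (J : ℝ) ≤ (J : ℝ) ^ (d + 1) := le_self_pow₀ hJ1 (by omega)
      rw [le_div_iff₀ (by positivity)]
      calc (m : ℝ) * (J * p) ≤ (3 ^ d * I * (5 * (ε * T))) * ((J : ℝ) ^ (d + 1) * p) := by gcongr
        _ = 5 / 2 * 3 ^ d * ((J : ℝ) ^ (d + 1) * I * (2 * (ε * T)) * p) := by ring
        _ ≤ 5 / 2 * 3 ^ d * C₀ := by gcongr
        _ ≤ 3 * 3 ^ d * C₀ := by gcongr; norm_num

lemma beta_le {r m : ℕ} (W : Measure ℝ) (τ : ℝ) {K : Set ℝ} (hK : IsCGAP r m K) :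
    beta r m W τ ≤ W.real (cthickening τ K)ᶜ :=
  ciInf_le (f := fun K : {K : Set ℝ // IsCGAP r m K} => (W (cthickening τ (K : Set ℝ))ᶜ).toReal)
    ⟨0, by rintro _ ⟨K, rfl⟩; exact ENNReal.toReal_nonneg⟩ ⟨K, hK⟩

lemma exists_measureReal_abs_le (W : Measure ℝ) [IsProbabilityMeasure W] {δ : ℝ} (hδ : 0 < δ) :
    ∃ X : ℝ, W.real {x | ¬ |x| ≤ X} ≤ δ := by
  have hanti : Antitone fun k : ℕ => {x : ℝ | ¬ |x| ≤ k} := by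
    intro i j hij x hx hxi
    exact hx (hxi.trans (by exact_mod_cast hij))
  have hempty : ⋂ k : ℕ, {x : ℝ | ¬ |x| ≤ k} = ∅ := by
    ext x
    simp only [Set.mem_iInter, Set.mem_ofPred_eq, Set.mem_empty_iff_false, iff_false, not_forall,
      not_not]
    exact exists_nat_ge |x|
  have hlim := tendsto_measure_iInter_atTop (μ := W) (s := fun k : ℕ => {x : ℝ | ¬ |x| ≤ k})
    (fun k => (measurableSet_le measurable_norm measurable_const).compl.nullMeasurableSet) hanti
    ⟨0, measure_ne_top _ _⟩
  rw [hempty, measure_empty] at hlim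
  obtain ⟨k, hk⟩ := (hlim.eventually_lt_const (ENNReal.ofReal_pos.mpr hδ)).exists
  exact ⟨k, ENNReal.toReal_le_of_le_ofReal hδ.le hk.le⟩

lemma pow_two_mul_le_rpow (r : ℕ) :
    (((r : ℝ) + 1) ^ 2) ^ (r + 1) ≤ 4 ^ (r + 1) * ((r : ℝ) + 1) ^ (5 * (r : ℝ) / 2) := by
  have h1 : (1 : ℝ) ≤ (r : ℝ) + 1 := by linarith [(Nat.cast_nonneg r : (0 : ℝ) ≤ r)]
  have h2 : ((r : ℝ) + 1) ^ (2 * r) ≤ ((r : ℝ) + 1) ^ (5 * (r : ℝ) / 2) := by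
    rw [← Real.rpow_natCast]
    refine Real.rpow_le_rpow_of_exponent_le h1 ?_
    push_cast
    linarith [(Nat.cast_nonneg r : (0 : ℝ) ≤ r)]
  have h3 := sq_le_four_pow (r + 1)
  push_cast at h3
  calc (((r : ℝ) + 1) ^ 2) ^ (r + 1) = ((r : ℝ) + 1) ^ 2 * ((r : ℝ) + 1) ^ (2 * r) := by
        rw [← pow_mul, ← pow_add]; congr 1; ring
    _ ≤ _ := by gcongr

/-- The bound on the concentration function, unless `W` is captured. -/
lemma concFn_le_or_isCaptured {W D : Measure ℝ} [IsProbabilityMeasure W] [IsProbabilityMeasure D]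
    {C₀ : ℝ} (hC₀ : 1 ≤ C₀)
    (hsieve : ∀ (T p : ℝ) (ν : Measure ℝ), 0 < T → 0 < p → IsProbabilityMeasure ν →
      ν ≤ ENNReal.ofReal (1 / (p * T)) • (volume.restrict (Set.Icc (-T) T)) →
      ∀ Z : Finset ℝ, (∀ z ∈ Z, ∀ w ∈ Z, z ≠ w → 1 / (2 * T) ≤ |z - w|) →
      (∀ z ∈ Z, 1 / 2 ≤ ∫ t, Real.cos (2 * Real.pi * (t * z)) ∂ν) → (#Z : ℝ) ≤ C₀ / p)
    {α T β X τ : ℝ} (hα : 0 < α)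
    (hD : ∀ t : ℝ, (∫ x, Complex.exp (t * x * Complex.I) ∂D) =
          Complex.exp ((α : ℂ) * ((∫ x, Complex.exp (t * x * Complex.I) ∂W) - 1)))
    (hT : 0 < T) (hτ : τ * T ≤ 1) (hβ : 0 < β) {r m : ℕ} (hm : 0 < m)
    (hX : W.real {x | ¬ |x| ≤ X} ≤ β / 16) :
    concFn D τ ≤ (184320 * C₀) ^ (r + 1) * (1 / (m * √(α * β)) +
      ((r : ℝ) + 1) ^ ((5 * (r : ℝ)) / 2) / (α * β) ^ (((r : ℝ) + 1) / 2)) ∨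
    ∃ (d : ℕ) (C : Set (Fin d → ℝ)) (x : Fin d → ℝ) (ε : ℝ), IsCaptured W r m β X T C x ε := by
  obtain ⟨a, ha, haα, hmono, hInt⟩ := exists_intensity W hα hT r.succ_pos
  have hm0 : (0 : ℝ) < m := by exact_mod_cast hm
  have hsqrt : 0 < √(α * β) := Real.sqrt_pos.mpr (by positivity)
  have hconc : concFn D τ ≤ 3 * triMean W T α := ciSup_le (measure_closedBall_le hD hT hτ)
  have hmono' : triMean W T α * √(α * β) ^ (r + 1) ≤ triMean W T a * √(a * β) ^ (r + 1) := by
    rw [Real.sqrt_mul hα.le, Real.sqrt_mul ha.le, mul_pow, mul_pow, ← mul_assoc, ← mul_assoc]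
    gcongr
  have hle : √(a * β) ≤ √(α * β) := by gcongr
  have hrpow : (α * β) ^ (((r : ℝ) + 1) / 2) = √(α * β) ^ (r + 1) := by
    rw [Real.sqrt_eq_rpow, ← Real.rpow_natCast, ← Real.rpow_mul (by positivity)]
    congr 1
    push_cast
    ring
  have h12 : (3 : ℝ) * 4 ^ (r + 1) ≤ 12 ^ (r + 1) := by
    rw [show (12 : ℝ) = 3 * 4 by norm_num, mul_pow]
    gcongr
    exact le_self_pow₀ (by norm_num) r.succ_ne_zero
  have hsplit : (184320 * C₀) ^ (r + 1) = 12 ^ (r + 1) * (15360 * C₀) ^ (r + 1) := by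
    rw [← mul_pow]; ring
  rw [hrpow, mul_add]
  rcases triMean_le_or_isCaptured hC₀ hsieve hT ha hβ hm hX hInt with h | h | h
  · left
    have h1 : triMean W T α ≤ (15360 * C₀) ^ (r + 1) *
        (4 ^ (r + 1) * ((r : ℝ) + 1) ^ (5 * (r : ℝ) / 2)) / √(α * β) ^ (r + 1) := by
      rw [le_div_iff₀ (by positivity)]
      refine (hmono'.trans h).trans ?_
      rw [mul_pow]
      gcongr
      exact pow_two_mul_le_rpow r
    refine le_add_of_nonneg_of_le (by positivity) ?_
    calc concFn D τ ≤ 3 * triMean W T α := hconc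
      _ ≤ 3 * ((15360 * C₀) ^ (r + 1) *
        (4 ^ (r + 1) * ((r : ℝ) + 1) ^ (5 * (r : ℝ) / 2)) / √(α * β) ^ (r + 1)) := by gcongr
      _ = (3 * 4 ^ (r + 1)) * (15360 * C₀) ^ (r + 1) *
          (((r : ℝ) + 1) ^ (5 * (r : ℝ) / 2) / √(α * β) ^ (r + 1)) := by ring
      _ ≤ _ := by rw [hsplit]; gcongr
  · left
    have hp := (triMean_pos W hT ha.le).le
    have hpα := (triMean_pos W hT hα.le).le
    have h1 : triMean W T α ≤ (15360 * C₀) ^ (r + 1) * (1 / (m * √(α * β))) := by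
      rw [mul_one_div, le_div_iff₀ (by positivity)]
      refine le_of_mul_le_mul_right ?_ (pow_pos hsqrt r)
      calc triMean W T α * (m * √(α * β)) * √(α * β) ^ r
          = triMean W T α * √(α * β) ^ (r + 1) * m := by ring
        _ ≤ triMean W T a * √(a * β) ^ (r + 1) * m := by gcongr
        _ = triMean W T a * √(a * β) * m * √(a * β) ^ r := by ring
        _ ≤ (15360 * C₀) ^ (r + 1) * √(α * β) ^ r := by gcongr
    refine le_add_of_le_of_nonneg ?_ (by positivity)
    have h3 : (3 : ℝ) ≤ 12 ^ (r + 1) :=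
      le_trans (by norm_num) (le_self_pow₀ (a := (12 : ℝ)) (by norm_num) r.succ_ne_zero)
    calc concFn D τ ≤ 3 * triMean W T α := hconc
      _ ≤ 12 ^ (r + 1) * ((15360 * C₀) ^ (r + 1) * (1 / (m * √(α * β)))) := by gcongr
      _ = _ := by rw [hsplit]; ring
  · exact .inr h

lemma IsCaptured.beta_le {W : Measure ℝ} [IsProbabilityMeasure W] {r m d : ℕ} {β X T τ ε : ℝ}
    {C : Set (Fin d → ℝ)} {x : Fin d → ℝ} (h : IsCaptured W r m β X T C x ε) (hT : 1 / T ≤ τ) :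
    beta r m W τ ≤ β / 2 := by
  obtain ⟨K, hK, hcover⟩ := h.cover
  refine (_root_.beta_le W τ hK).trans ((measureReal_mono ?_).trans h.near)
  rintro y hy ⟨c, hc, hyc⟩
  obtain ⟨z, hz, hyz⟩ := hcover c hc y hyc
  exact hy (mem_cthickening_of_dist_le y z τ K hz (hyz.trans hT))

/-- Captures at arbitrarily small scales pass to the limit. -/
lemma beta_zero_le_of_isCaptured {W : Measure ℝ} [IsProbabilityMeasure W] {r m : ℕ} {β X : ℝ}
    (hβ : 0 ≤ β) (h : ∀ k : ℕ, ∃ (d : ℕ) (C : Set (Fin d → ℝ)) (x : Fin d → ℝ) (ε : ℝ),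
      IsCaptured W r m β X (k + 1) C x ε) : beta r m W 0 ≤ β / 2 := by
  choose d C x ε hcap using h
  have (d : Fin (r + 1)) : Finite {C : Set (Fin d → ℝ) // C ⊆ factorialGrid d m} :=
    (factorialGrid_finite d m).finite_subsets
  let f (k : ℕ) : Σ d : Fin (r + 1), {C : Set (Fin d → ℝ) // C ⊆ factorialGrid d m} :=
    ⟨⟨d k, Nat.lt_succ_of_le (hcap k).rank_le⟩, C k, (hcap k).subset_grid⟩
  obtain ⟨⟨d₀, C₀, hC₀⟩, hinf⟩ := Finite.exists_infinite_fiber f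
  have hfreq : ∀ k ∈ f ⁻¹' {⟨d₀, C₀, hC₀⟩}, ∃ (x : Fin d₀ → ℝ) (ε : ℝ),
      IsCaptured W r m β X (k + 1) C₀ x ε := by
    intro k hk
    have h1 : ∀ s : Σ d : Fin (r + 1), {C : Set (Fin d → ℝ) // C ⊆ factorialGrid d m},
        f k = s → ∃ (x : Fin s.1 → ℝ) (ε : ℝ), IsCaptured W r m β X (k + 1) s.2.1 x ε := by
      rintro s rfl
      exact ⟨x k, ε k, hcap k⟩
    exact h1 _ hk
  obtain ⟨φ, hφ, hφmem⟩ := Filter.extraction_of_frequently_atTop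
    (Nat.frequently_atTop_iff_infinite.mpr (Set.infinite_coe_iff.mp hinf))
  choose y η hy using fun k => hfreq (φ k) (hφmem k)
  obtain ⟨y₀, -, ψ, hψ, hlim⟩ := (isCompact_univ_pi fun _ : Fin d₀ =>
    isCompact_Icc (a := -X) (b := X)).tendsto_subseq (x := y)
      fun k i _ => abs_le.mp ((hy k).abs_le i)
  set K := (fun c : Fin d₀ → ℝ => ∑ i, c i * y₀ i) '' C₀
  have hK : IsCGAP r m K := ((hy 0).isCGAP y₀).mono_rank (hy 0).rank_le
  refine (beta_le W 0 hK).trans ?_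
  have hsub : (cthickening 0 K)ᶜ ⊆ ⋃ j : ℕ, {z | ∀ w ∈ K, 1 / ((j : ℝ) + 1) ≤ |z - w|} := by
    intro z hz
    rw [cthickening_zero, Set.mem_compl_iff, Metric.mem_closure_iff] at hz
    push Not at hz
    obtain ⟨δ, hδ, hz⟩ := hz
    obtain ⟨j, hj⟩ := exists_nat_one_div_lt hδ
    exact Set.mem_iUnion.mpr ⟨j, fun w hw => hj.le.trans (hz w hw)⟩
  have hmono : Monotone fun j : ℕ => {z | ∀ w ∈ K, 1 / ((j : ℝ) + 1) ≤ |z - w|} := by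
    intro i j hij z hz w hw
    refine le_trans ?_ (hz w hw)
    gcongr
  refine ENNReal.toReal_le_of_le_ofReal (by positivity) ((measure_mono hsub).trans ?_)
  rw [hmono.measure_iUnion]
  refine iSup_le fun j => ?_
  rw [← ENNReal.toReal_le_toReal (measure_ne_top _ _) ENNReal.ofReal_ne_top,
    ENNReal.toReal_ofReal (by positivity)]
  have herr : Filter.Tendsto
      (fun k => (m : ℝ) / ((φ (ψ k) : ℕ) + 1 : ℝ) + ∑ i, |y (ψ k) i - y₀ i|)
      Filter.atTop (nhds 0) := by
    have h1 : Filter.Tendsto (fun k => (m : ℝ) / ((φ (ψ k) : ℕ) + 1 : ℝ))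
        Filter.atTop (nhds 0) :=
      (tendsto_const_nhds.div_atTop (Filter.tendsto_atTop_add_const_right _ _
        tendsto_natCast_atTop_atTop)).comp (hφ.comp hψ).tendsto_atTop
    have h2 : Filter.Tendsto (fun k => ∑ i, |y (ψ k) i - y₀ i|) Filter.atTop (nhds 0) := by
      have h3 : Continuous fun v : Fin d₀ → ℝ => ∑ i, |v i - y₀ i| := by fun_prop
      simpa [Function.comp_def] using (h3.tendsto y₀).comp hlim
    simpa using h1.add h2
  obtain ⟨k, hk⟩ := (herr.eventually_lt_const
    (show (0 : ℝ) < 1 / ((j : ℝ) + 1) by positivity)).exists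
  refine (measureReal_mono ?_).trans (hy (ψ k)).near
  rintro z hz ⟨c, hc, hzc⟩
  have h1 := hz _ ⟨c, hc, rfl⟩
  have h2 : |∑ i, c i * y (ψ k) i - ∑ i, c i * y₀ i| ≤ ∑ i, |y (ψ k) i - y₀ i| := by
    rw [← Finset.sum_sub_distrib]
    refine (Finset.abs_sum_le_sum_abs _ _).trans (Finset.sum_le_sum fun i _ => ?_)
    rw [← mul_sub, abs_mul]
    exact mul_le_of_le_one_left (abs_nonneg _) ((hC₀ hc).1 i)
  have h3 := abs_sub_le z (∑ i, c i * y (ψ k) i) (∑ i, c i * y₀ i)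
  have h4 := hzc.trans (hy (ψ k)).le
  linarith

theorem stmt_6 :
    ∃ c₂ : ℝ, 0 < c₂ ∧
      ∀ W : Measure ℝ, IsProbabilityMeasure W →
      ∀ α : ℝ, 0 < α →
      ∀ D : Measure ℝ, IsProbabilityMeasure D →
        (∀ t : ℝ, (∫ x, Complex.exp (t * x * Complex.I) ∂D) =
          Complex.exp ((α : ℂ) * ((∫ x, Complex.exp (t * x * Complex.I) ∂W) - 1))) →
      ∀ τ : ℝ, 0 ≤ τ →
      ∀ r m : ℕ, 0 < m → 0 < beta r m W τ →
        concFn D τ ≤ c₂ ^ (r + 1) *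
          (1 / (m * Real.sqrt (α * beta r m W τ)) +
            ((r : ℝ) + 1) ^ ((5 * (r : ℝ)) / 2) /
              (α * beta r m W τ) ^ (((r : ℝ) + 1) / 2)) := by
  obtain ⟨C₀, hC₀, hsieve⟩ := exists_sieve_const
  refine ⟨184320 * C₀, by positivity, fun W _ α hα D _ hD τ hτ r m hm hβ => ?_⟩
  obtain ⟨X, hX⟩ := exists_measureReal_abs_le W (δ := beta r m W τ / 16) (by positivity)
  rcases hτ.eq_or_lt with rfl | hτ
  · by_contra hnot
    have := beta_zero_le_of_isCaptured hβ.le fun k : ℕ =>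
      (concFn_le_or_isCaptured hC₀ hsieve hα hD (by positivity : (0 : ℝ) < k + 1) (by simp) hβ hm
        hX).resolve_left hnot
    linarith
  · rcases concFn_le_or_isCaptured hC₀ hsieve hα hD (one_div_pos.mpr hτ)
      (mul_one_div_cancel hτ.ne').le hβ hm hX (r := r) with h | ⟨d, C, x, ε, h⟩
    · exact h
    · have := h.beta_le (one_div_one_div τ).le
      linarith
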